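/- (Ritt) If (f_k, …, f_1) and (g_k, …, g_1) are two decompositions of the same polynomial f ∈ ℂ[x], then (g_k, …, g_1) is linearly equivalent to a decomposition obtained from (f_k, …, f_1) by a finite sequence of Ritt swaps; that is, there is a finite chain of decompositions of f starting at (f_k, …, f_1), each obtained from the previous one by a Ritt swap at some index, whose last term is linearly equivalent to (g_k, …, g_1). -/

import Mathlib

open Polynomial

noncomputable section

/-- A linear polynomial `L(x) = Ax + B` with `A ≠ 0`, i.e. of degree exactly 1. -/
def IsLinearPoly (L : ℂ[X]) : Prop := L.natDegree = 1

/-- A polynomial over ℂ is indecomposable if it has degree at least 2 and cannot be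
written as the composition of two polynomials each of degree at least 2. -/
def Indecomposable (f : ℂ[X]) : Prop :=
  2 ≤ f.natDegree ∧ ¬ ∃ g h : ℂ[X], 2 ≤ g.natDegree ∧ 2 ≤ h.natDegree ∧ f = g.comp h

/-- A decomposition of `f` is a nonempty list `[f₁, …, f_k]` (innermost factor first) of
indecomposable polynomials with `f = f_k ∘ ⋯ ∘ f₁`. -/
def IsDecomposition (l : List ℂ[X]) (f : ℂ[X]) : Prop :=
  l ≠ [] ∧ (∀ p ∈ l, Indecomposable p) ∧ l.foldl (fun q p => p.comp q) X = f

/-- `f` is the degree-`n` Chebyshev polynomial: the unique polynomial with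
`f(x + 1/x) = x^n + 1/x^n` for all `x ≠ 0`. -/
def IsChebyshev (n : ℕ) (f : ℂ[X]) : Prop :=
  ∀ x : ℂ, x ≠ 0 → f.eval (x + x⁻¹) = x ^ n + x⁻¹ ^ n

/-- A ritty polynomial: an indecomposable polynomial equal to `x²`, or `x^p` (`p` an odd
prime), or the Chebyshev polynomial `C_p` (`p` an odd prime), or
`x^k · u(x^ℓ)^n` with `k ≥ 1`, `gcd(k,ℓ) = gcd(k,n) = 1`, `u` monic non-constant,
`u(0) ≠ 0`, and `ℓ > 1` or `n > 1`. -/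
def IsRitty (f : ℂ[X]) : Prop :=
  Indecomposable f ∧
  (f = X ^ 2 ∨
   (∃ p : ℕ, p.Prime ∧ Odd p ∧ f = X ^ p) ∨
   (∃ p : ℕ, p.Prime ∧ Odd p ∧ IsChebyshev p f) ∨
   (∃ (k el n : ℕ) (u : ℂ[X]), 1 ≤ k ∧ 1 ≤ el ∧ 1 ≤ n ∧
     Nat.gcd k el = 1 ∧ Nat.gcd k n = 1 ∧
     u.Monic ∧ 0 < u.natDegree ∧ u.eval 0 ≠ 0 ∧ (1 < el ∨ 1 < n) ∧
     f = X ^ k * (u.comp (X ^ el)) ^ n))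

/-- `a ∘ b = c ∘ d` is an instance of a basic Ritt identity:
`x^p ∘ x^q = x^q ∘ x^p` for distinct primes `p ≠ q`;
`C_p ∘ C_q = C_q ∘ C_p` for distinct odd primes;
or `x^p ∘ (x^k·u(x^{ℓp})^n) = (x^k·u(x^ℓ)^{pn}) ∘ x^p` (in either orientation),
with both non-monomial factors ritty. -/
def BasicRittIdentity (a b c d : ℂ[X]) : Prop :=
  a.comp b = c.comp d ∧
  ((∃ p q : ℕ, p.Prime ∧ q.Prime ∧ p ≠ q ∧
      a = X ^ p ∧ b = X ^ q ∧ c = X ^ q ∧ d = X ^ p) ∨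
   (∃ p q : ℕ, p.Prime ∧ q.Prime ∧ Odd p ∧ Odd q ∧ p ≠ q ∧
      IsChebyshev p a ∧ IsChebyshev q b ∧ IsChebyshev q c ∧ IsChebyshev p d) ∨
   (∃ (p k el n : ℕ) (u : ℂ[X]), p.Prime ∧
      a = X ^ p ∧ b = X ^ k * (u.comp (X ^ (el * p))) ^ n ∧
      c = X ^ k * (u.comp (X ^ el)) ^ (p * n) ∧ d = X ^ p ∧
      IsRitty b ∧ IsRitty c) ∨
   (∃ (p k el n : ℕ) (u : ℂ[X]), p.Prime ∧
      a = X ^ k * (u.comp (X ^ el)) ^ (p * n) ∧ b = X ^ p ∧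
      c = X ^ p ∧ d = X ^ k * (u.comp (X ^ (el * p))) ^ n ∧
      IsRitty a ∧ IsRitty d))

/-- `m` is obtained from `l` by a Ritt swap at (0-based) position `j`, i.e. at the pair of
factors in positions `j` and `j+1` (innermost factor first).  This says the other
factors agree and there are linear polynomials `L, M, N` with
`(L⁻¹ ∘ l_{j+1} ∘ M) ∘ (M⁻¹ ∘ l_j ∘ N) = R ∘ S` a basic Ritt identity,
`m_{j+1} = L ∘ R` and `m_j = S ∘ N⁻¹`; inverses are eliminated by cross-multiplying. -/
def RittSwapAt (j : ℕ) (l m : List ℂ[X]) : Prop :=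
  l.length = m.length ∧ j + 1 < l.length ∧
  (∀ i, i ≠ j → i ≠ j + 1 → l.getD i 0 = m.getD i 0) ∧
  ∃ L M N A B R S : ℂ[X],
    IsLinearPoly L ∧ IsLinearPoly M ∧ IsLinearPoly N ∧
    L.comp A = (l.getD (j + 1) 0).comp M ∧
    M.comp B = (l.getD j 0).comp N ∧
    BasicRittIdentity A B R S ∧
    m.getD (j + 1) 0 = L.comp R ∧
    (m.getD j 0).comp N = S

/-- Linear equivalence of decompositions `[l₁,…,l_k]` and `[m₁,…,m_k]` (innermost first):
there are linear polynomials `L₁, …, L_{k-1}` (with `L₀ = L_k = x` the identity) such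
that `m_i = L_i⁻¹ ∘ l_i ∘ L_{i-1}` for each `i`; inverses are eliminated by
cross-multiplying. -/
def LinearEquivalent (l m : List ℂ[X]) : Prop :=
  l.length = m.length ∧
  ∃ L : ℕ → ℂ[X], L 0 = X ∧ L l.length = X ∧
    (∀ i, 0 < i → i < l.length → IsLinearPoly (L i)) ∧
    ∀ i < l.length, (L (i + 1)).comp (m.getD i 0) = (l.getD i 0).comp (L i)

/-- The series `u` has no exponents below `-k`, and its coefficient at `-k` is `c`. -/
def HasLead (k : ℕ) (c : ℂ) (u : HahnSeries ℤ ℂ) : Prop :=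
  ∃ U : PowerSeries ℂ, PowerSeries.constantCoeff U = c ∧
    u = HahnSeries.single (-(k : ℤ)) 1 * HahnSeries.ofPowerSeries ℤ ℂ U

namespace HasLead

variable {k l : ℕ} {c d : ℂ} {u v : HahnSeries ℤ ℂ}

theorem coeff_eq (h : HasLead k c u) : u.coeff (-(k : ℤ)) = c := by
  obtain ⟨U, hU, rfl⟩ := h
  rw [HahnSeries.coeff_single_mul]
  have := HahnSeries.ofPowerSeries_apply_coeff (Γ := ℤ) U 0
  simp only [Nat.cast_zero] at this
  simp [this, hU]

theorem ne_zero (h : HasLead k c u) (hc : c ≠ 0) : u ≠ 0 := by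
  rintro rfl
  exact hc (by simpa using h.coeff_eq.symm)

theorem unique (h : HasLead k c u) (h' : HasLead k d u) : c = d :=
  h.coeff_eq.symm.trans h'.coeff_eq

theorem zero : HasLead k 0 0 := ⟨0, by simp, by simp⟩

theorem const (c : ℂ) : HasLead 0 c (HahnSeries.C c) :=
  ⟨PowerSeries.C c, by simp, by rw [HahnSeries.ofPowerSeries_C]; simp⟩

theorem add (h : HasLead k c u) (h' : HasLead k d v) : HasLead k (c + d) (u + v) := by
  obtain ⟨U, hU, rfl⟩ := h
  obtain ⟨V, hV, rfl⟩ := h'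
  exact ⟨U + V, by simp [hU, hV], by simp [mul_add]⟩

theorem mul (h : HasLead k c u) (h' : HasLead l d v) : HasLead (k + l) (c * d) (u * v) := by
  obtain ⟨U, hU, rfl⟩ := h
  obtain ⟨V, hV, rfl⟩ := h'
  refine ⟨U * V, by simp [hU, hV], ?_⟩
  rw [map_mul, mul_mul_mul_comm, HahnSeries.single_mul_single]
  congr 2
  · congr 1
    push_cast
    ring
  · simp

theorem neg (h : HasLead k c u) : HasLead k (-c) (-u) := by
  obtain ⟨U, hU, rfl⟩ := h
  exact ⟨-U, by simp [hU], by rw [map_neg]; ring⟩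

theorem sub (h : HasLead k c u) (h' : HasLead k d v) : HasLead k (c - d) (u - v) := by
  simpa [sub_eq_add_neg] using h.add h'.neg

theorem pow (h : HasLead k c u) (i : ℕ) : HasLead (i * k) (c ^ i) (u ^ i) := by
  induction i with
  | zero => simpa using HasLead.const 1
  | succ i ih => simpa [pow_succ, add_mul] using ih.mul h

theorem mono (h : HasLead k c u) (hkl : k < l) : HasLead l 0 u := by
  obtain ⟨U, hU, rfl⟩ := h
  obtain ⟨j, rfl⟩ := Nat.exists_eq_add_of_lt hkl
  refine ⟨PowerSeries.X ^ (j + 1) * U, by simp, ?_⟩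
  rw [map_mul, HahnSeries.ofPowerSeries_X_pow, ← mul_assoc, HahnSeries.single_mul_single]
  congr 2
  · congr 1
    push_cast
    omega
  · simp

theorem sum {ι : Type*} (s : Finset ι) {f : ι → HahnSeries ℤ ℂ} {g : ι → ℂ}
    (h : ∀ i ∈ s, HasLead k (g i) (f i)) : HasLead k (∑ i ∈ s, g i) (∑ i ∈ s, f i) := by
  classical
  induction s using Finset.induction_on with
  | empty => simpa using HasLead.zero
  | insert a s ha ih =>
    rw [Finset.sum_insert ha, Finset.sum_insert ha]
    exact (h a (Finset.mem_insert_self a s)).add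
      (ih fun i hi => h i (Finset.mem_insert_of_mem hi))

theorem eval₂ (h : HasLead k c u) (hk : 0 < k) (p : ℂ[X]) {n : ℕ} (hn : p.natDegree ≤ n) :
    HasLead (n * k) (p.coeff n * c ^ n) (p.eval₂ HahnSeries.C u) := by
  rw [Polynomial.eval₂_eq_sum_range' _ (Nat.lt_succ_of_le hn)]
  have key : HasLead (n * k) (∑ i ∈ Finset.range (n + 1), if i = n then p.coeff n * c ^ n else 0)
      (∑ i ∈ Finset.range (n + 1), HahnSeries.C (p.coeff i) * u ^ i) := by
    refine HasLead.sum _ fun i hi => ?_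
    have h1 := (HasLead.const (p.coeff i)).mul (h.pow i)
    rw [zero_add] at h1
    split_ifs with hin
    · exact hin ▸ h1
    · refine h1.mono (Nat.mul_lt_mul_of_pos_right ?_ hk)
      have := Finset.mem_range.1 hi
      omega
  simpa using key

end HasLead

theorem isPWO_support_twist (ζ : ℂ) (u : HahnSeries ℤ ℂ) :
    (Function.support fun k : ℤ => ζ ^ k * u.coeff k).IsPWO :=
  u.isPWO_support.mono (Function.support_subset_iff'.2 fun k hk => by
    rw [HahnSeries.mem_support, not_not] at hk
    rw [hk, mul_zero])

/-- The additive automorphism `T ↦ ζ T` of Laurent series in `T`. -/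
def twistFun (ζ : ℂ) (u : HahnSeries ℤ ℂ) : HahnSeries ℤ ℂ :=
  ⟨fun k => ζ ^ k * u.coeff k, isPWO_support_twist ζ u⟩

theorem coeff_twistFun (ζ : ℂ) (u : HahnSeries ℤ ℂ) (k : ℤ) :
    (twistFun ζ u).coeff k = ζ ^ k * u.coeff k := rfl

theorem support_twistFun (ζ : ℂ) (u : HahnSeries ℤ ℂ) :
    (twistFun ζ u).support ⊆ u.support := fun k hk => by
  rw [HahnSeries.mem_support, coeff_twistFun] at hk
  exact right_ne_zero_of_mul hk

/-- The automorphism `T ↦ ζ T` of Laurent series in `T`. -/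
def twist (ζ : ℂ) (hζ : ζ ≠ 0) : HahnSeries ℤ ℂ →+* HahnSeries ℤ ℂ where
  toFun := twistFun ζ
  map_one' := by
    ext k
    by_cases hk : k = 0 <;> simp [coeff_twistFun, HahnSeries.coeff_one, hk]
  map_zero' := by ext k; simp [coeff_twistFun]
  map_add' u v := by ext k; simp [coeff_twistFun, mul_add]
  map_mul' u v := by
    ext k
    have hs : (twistFun ζ u * twistFun ζ v).coeff k =
        ∑ ij ∈ Finset.antidiagonal u.isPWO_support v.isPWO_support k,
          (twistFun ζ u).coeff ij.1 * (twistFun ζ v).coeff ij.2 := by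
      rw [HahnSeries.coeff_mul]
      refine Finset.sum_subset (fun ij h => ?_) fun ij h h' => ?_
      · rw [Finset.mem_antidiagonal] at h ⊢
        exact ⟨support_twistFun ζ u h.1, support_twistFun ζ v h.2.1, h.2.2⟩
      · rw [Finset.mem_antidiagonal] at h h'
        by_contra hne
        exact h' ⟨left_ne_zero_of_mul hne, right_ne_zero_of_mul hne, h.2.2⟩
    rw [hs, coeff_twistFun, HahnSeries.coeff_mul, Finset.mul_sum]
    refine Finset.sum_congr rfl fun ij h => ?_
    rw [coeff_twistFun, coeff_twistFun, ← (Finset.mem_antidiagonal.1 h).2.2, zpow_add₀ hζ]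
    ring

theorem coeff_twist (ζ : ℂ) (hζ : ζ ≠ 0) (u : HahnSeries ℤ ℂ) (k : ℤ) :
    (twist ζ hζ u).coeff k = ζ ^ k * u.coeff k := rfl

theorem twist_C (ζ : ℂ) (hζ : ζ ≠ 0) (c : ℂ) :
    twist ζ hζ (HahnSeries.C c) = HahnSeries.C c := by
  ext k
  by_cases hk : k = 0 <;> simp [coeff_twist, HahnSeries.C_apply, hk]

theorem twist_single (ζ : ℂ) (hζ : ζ ≠ 0) (k : ℤ) (c : ℂ) :
    twist ζ hζ (HahnSeries.single k c) = HahnSeries.single k (ζ ^ k * c) := by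
  ext j
  by_cases hj : j = k
  · simp [coeff_twist, hj]
  · simp [coeff_twist, HahnSeries.coeff_single_of_ne hj]

theorem twist_eval₂ (ζ : ℂ) (hζ : ζ ≠ 0) (p : ℂ[X]) (u : HahnSeries ℤ ℂ) :
    twist ζ hζ (p.eval₂ HahnSeries.C u) = p.eval₂ HahnSeries.C (twist ζ hζ u) := by
  rw [Polynomial.hom_eval₂]
  congr 1
  ext1 c
  exact twist_C ζ hζ c

theorem twist_ofPowerSeries (ζ : ℂ) (hζ : ζ ≠ 0) (U : PowerSeries ℂ) :
    twist ζ hζ (HahnSeries.ofPowerSeries ℤ ℂ U) =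
      HahnSeries.ofPowerSeries ℤ ℂ (PowerSeries.rescale ζ U) := by
  ext k
  rw [coeff_twist]
  have h1 := PowerSeries.coeff_coe U k
  have h2 := PowerSeries.coeff_coe (PowerSeries.rescale ζ U) k
  rw [h1, h2]
  split_ifs with hk
  · simp
  · rw [PowerSeries.coeff_rescale, ← zpow_natCast, Int.natAbs_of_nonneg (not_lt.1 hk)]

theorem HasLead.twist {k : ℕ} {c : ℂ} {u : HahnSeries ℤ ℂ} (h : HasLead k c u) (ζ : ℂ)
    (hζ : ζ ≠ 0) : HasLead k (ζ ^ (-(k : ℤ)) * c) (twist ζ hζ u) := by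
  obtain ⟨U, hU, rfl⟩ := h
  refine ⟨PowerSeries.C (ζ ^ (-(k : ℤ))) * PowerSeries.rescale ζ U, ?_, ?_⟩
  · rw [map_mul, PowerSeries.constantCoeff_C, ← hU, ← PowerSeries.coeff_zero_eq_constantCoeff_apply,
      ← PowerSeries.coeff_zero_eq_constantCoeff_apply, PowerSeries.coeff_rescale, pow_zero, one_mul]
  · rw [(_root_.twist ζ hζ).map_mul, twist_ofPowerSeries, twist_single,
      (HahnSeries.ofPowerSeries ℤ ℂ).map_mul, HahnSeries.ofPowerSeries_C, ← mul_assoc,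
      HahnSeries.C_apply, HahnSeries.single_mul_single]
    simp

theorem eval₂_eq_of_leads {r : ℕ} {c : ℂ} {u v : HahnSeries ℤ ℂ} (hr : 0 < r) (hc : c ≠ 0)
    (hu : HasLead r c u) (hv : HasLead r c v) (a : ℂ[X]) (ha : 0 < a.natDegree)
    (h : a.eval₂ HahnSeries.C u = a.eval₂ HahnSeries.C v) : u = v := by
  set s := a.natDegree with hs
  set Q : HahnSeries ℤ ℂ := ∑ i ∈ Finset.range (s + 1), HahnSeries.C (a.coeff i) *
    ∑ j ∈ Finset.range i, u ^ j * v ^ (i - 1 - j) with hQ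
  have hfac : Q * (u - v) = a.eval₂ HahnSeries.C u - a.eval₂ HahnSeries.C v := by
    rw [Polynomial.eval₂_eq_sum_range, Polynomial.eval₂_eq_sum_range, ← Finset.sum_sub_distrib, hQ,
      Finset.sum_mul]
    refine Finset.sum_congr rfl fun i _ => ?_
    rw [mul_assoc, geom_sum₂_mul, mul_sub]
  have hlead : HasLead ((s - 1) * r) (∑ i ∈ Finset.range (s + 1),
      if i = s then a.coeff s * (s * c ^ (s - 1)) else 0) Q := by
    refine HasLead.sum _ fun i hi => ?_
    have hin : HasLead ((i - 1) * r) (i * c ^ (i - 1))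
        (∑ j ∈ Finset.range i, u ^ j * v ^ (i - 1 - j)) := by
      have : HasLead ((i - 1) * r) (∑ j ∈ Finset.range i, c ^ (i - 1))
          (∑ j ∈ Finset.range i, u ^ j * v ^ (i - 1 - j)) := by
        refine HasLead.sum _ fun j hj => ?_
        have hj' := Finset.mem_range.1 hj
        have h1 := (hu.pow j).mul (hv.pow (i - 1 - j))
        rwa [← add_mul, ← pow_add, show j + (i - 1 - j) = i - 1 by omega] at h1
      simpa using this
    have h1 := (HasLead.const (a.coeff i)).mul hin
    rw [zero_add] at h1
    split_ifs with his
    · exact his ▸ h1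
    · rcases Nat.eq_zero_or_pos i with rfl | hi0
      · simpa using HasLead.zero
      · refine h1.mono (Nat.mul_lt_mul_of_pos_right ?_ hr)
        have := Finset.mem_range.1 hi
        omega
  have hQ0 : Q ≠ 0 := by
    refine hlead.ne_zero ?_
    have : a.coeff s ≠ 0 := by
      rw [hs]
      exact Polynomial.leadingCoeff_ne_zero.2 (Polynomial.ne_zero_of_natDegree_gt ha)
    simp [this, hc, ha.ne']
  rw [h, sub_self] at hfac
  exact sub_eq_zero.1 ((mul_eq_zero.1 hfac).resolve_left hQ0)

/-- A Laurent series expansion of `x` at infinity in which the monic polynomial `f` becomes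
`T ^ (-deg f)`. -/
theorem exists_expansion (f : ℂ[X]) (hf : f.Monic) (hn : 0 < f.natDegree) :
    ∃ ξ : HahnSeries ℤ ℂ, HasLead 1 1 ξ ∧
      f.eval₂ HahnSeries.C ξ = HahnSeries.single (-(f.natDegree : ℤ)) 1 := by
  set n := f.natDegree with hnd
  let P : Polynomial (PowerSeries ℂ) := ∑ i ∈ Finset.range (n + 1),
    Polynomial.monomial i (PowerSeries.C (f.coeff i) * PowerSeries.X ^ (n - i)) - 1
  have hsum : ∀ w : PowerSeries ℂ, P.eval w =
      ∑ i ∈ Finset.range (n + 1), PowerSeries.C (f.coeff i) * PowerSeries.X ^ (n - i) * w ^ i - 1 :=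
    fun w => by simp [P, Polynomial.eval_finsetSum]
  have hfn : f.coeff n = 1 := hf.coeff_natDegree
  have hmonic : P.Monic := by
    have : P = Polynomial.X ^ n + (∑ i ∈ Finset.range n,
        Polynomial.monomial i (PowerSeries.C (f.coeff i) * PowerSeries.X ^ (n - i)) - 1) := by
      simp only [P, Finset.sum_range_succ, hfn, Nat.sub_self, map_one, pow_zero, mul_one,
        Polynomial.monomial_one_right_eq_X_pow]
      ring
    rw [this]
    refine Polynomial.monic_X_pow_add ?_
    refine (Polynomial.degree_sub_le _ _).trans_lt (max_lt ?_ ?_)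
    · refine (Polynomial.degree_sum_le _ _).trans_lt ?_
      refine (Finset.sup_lt_iff (WithBot.bot_lt_coe n)).2 ?_
      intro i hi
      exact (Polynomial.degree_monomial_le _ _).trans_lt
        (Nat.cast_lt.2 (Finset.mem_range.1 hi))
    · rw [Polynomial.degree_one]
      exact_mod_cast hn
  have hconst : ∀ w : PowerSeries ℂ, PowerSeries.constantCoeff w = 1 →
      PowerSeries.constantCoeff (P.eval w) = 0 := fun w hw => by
    rw [hsum, Finset.sum_range_succ]
    simp only [map_sub, map_add, map_sum, map_mul, map_pow, PowerSeries.constantCoeff_C,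
      PowerSeries.constantCoeff_X, hw, hfn, Nat.sub_self, pow_zero, map_one]
    rw [Finset.sum_eq_zero]
    · ring
    · intro i hi
      have := Finset.mem_range.1 hi
      simp [Nat.sub_ne_zero_of_lt this]
  have hderiv : PowerSeries.constantCoeff (P.derivative.eval 1) = n := by
    simp only [P, Polynomial.derivative_sub,
      Polynomial.derivative_monomial, Polynomial.derivative_one, sub_zero,
      Polynomial.eval_finsetSum, Polynomial.eval_monomial, one_pow, mul_one, map_sum,
      map_mul, map_pow, PowerSeries.constantCoeff_C, PowerSeries.constantCoeff_X, map_natCast]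
    rw [Finset.sum_range_succ, Finset.sum_eq_zero]
    · simp [hfn]
    · intro i hi
      have := Finset.mem_range.1 hi
      simp [Nat.sub_ne_zero_of_lt this]
  have hH : HenselianRing (PowerSeries ℂ) (Ideal.span {PowerSeries.X}) := inferInstance
  obtain ⟨w, hw, hw1⟩ := hH.is_henselian P hmonic 1
    (by
      rw [Ideal.mem_span_singleton, PowerSeries.X_dvd_iff]
      exact hconst 1 (by simp))
    (by
      refine IsUnit.map _ ?_
      rw [PowerSeries.isUnit_iff_constantCoeff, hderiv, isUnit_iff_ne_zero]
      exact_mod_cast hn.ne')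
  have hw1 : PowerSeries.constantCoeff w = 1 := by
    rw [Ideal.mem_span_singleton, PowerSeries.X_dvd_iff, map_sub, map_one] at hw1
    exact sub_eq_zero.1 hw1
  refine ⟨HahnSeries.single (-1) 1 * HahnSeries.ofPowerSeries ℤ ℂ w, ⟨w, hw1, by simp⟩, ?_⟩
  have hw2 : ∑ i ∈ Finset.range (n + 1),
      PowerSeries.C (f.coeff i) * PowerSeries.X ^ (n - i) * w ^ i = 1 :=
    sub_eq_zero.1 ((hsum w).symm.trans hw)
  have hw3 := congrArg (fun x => HahnSeries.single (-(n : ℤ)) (1 : ℂ) *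
    HahnSeries.ofPowerSeries ℤ ℂ x) hw2
  simp only [map_one, mul_one, map_sum, Finset.mul_sum] at hw3
  rw [← hw3, Polynomial.eval₂_eq_sum_range]
  refine Finset.sum_congr rfl fun i hi => ?_
  have hi' := Finset.mem_range.1 hi
  rw [(HahnSeries.ofPowerSeries ℤ ℂ).map_mul, (HahnSeries.ofPowerSeries ℤ ℂ).map_mul,
    (HahnSeries.ofPowerSeries ℤ ℂ).map_pow w, HahnSeries.ofPowerSeries_C,
    HahnSeries.ofPowerSeries_X_pow, mul_pow, HahnSeries.single_pow]
  have hs : HahnSeries.single (i • (-1 : ℤ)) ((1 : ℂ) ^ i) =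
      HahnSeries.single (-(n : ℤ)) 1 * HahnSeries.single ((n - i : ℕ) : ℤ) 1 := by
    rw [HahnSeries.single_mul_single]
    congr 2
    · rw [nsmul_eq_mul]
      omega
    · simp
  rw [hs]
  ring

/-- Expansion of polynomials along a Laurent series `ξ`. -/
def expandAt (ξ : HahnSeries ℤ ℂ) : ℂ[X] →+* HahnSeries ℤ ℂ :=
  Polynomial.eval₂RingHom HahnSeries.C ξ

theorem expandAt_apply (ξ : HahnSeries ℤ ℂ) (p : ℂ[X]) :
    expandAt ξ p = p.eval₂ HahnSeries.C ξ := rfl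

theorem expandAt_C (ξ : HahnSeries ℤ ℂ) (c : ℂ) : expandAt ξ (C c) = HahnSeries.C c := by
  simp [expandAt_apply]

theorem expandAt_X (ξ : HahnSeries ℤ ℂ) : expandAt ξ X = ξ := by
  simp [expandAt_apply]

theorem expandAt_comp (ξ : HahnSeries ℤ ℂ) (p q : ℂ[X]) :
    expandAt ξ (p.comp q) = p.eval₂ HahnSeries.C (expandAt ξ q) := by
  rw [Polynomial.comp, Polynomial.eval₂_eq_sum, Polynomial.eval₂_eq_sum, Polynomial.sum,
    Polynomial.sum, map_sum]
  simp only [map_mul, map_pow, expandAt_C]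

theorem hasLead_expandAt {ξ : HahnSeries ℤ ℂ} (hξ : HasLead 1 1 ξ) (p : ℂ[X]) :
    HasLead p.natDegree p.leadingCoeff (expandAt ξ p) := by
  simpa [expandAt_apply] using hξ.eval₂ one_pos p le_rfl

theorem expandAt_injective {ξ : HahnSeries ℤ ℂ} (hξ : HasLead 1 1 ξ) :
    Function.Injective (expandAt ξ) := by
  rw [injective_iff_map_eq_zero]
  intro p hp
  by_contra h
  exact (hasLead_expandAt hξ p).ne_zero (leadingCoeff_ne_zero.2 h) hp

theorem natDegree_le_of_hasLead {ξ : HahnSeries ℤ ℂ} (hξ : HasLead 1 1 ξ) {p : ℂ[X]} {k : ℕ} {c : ℂ}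
    (h : HasLead k c (expandAt ξ p)) : p.natDegree ≤ k := by
  by_contra! hk
  have h1 := (hasLead_expandAt hξ p).unique (h.mono hk)
  rw [leadingCoeff_eq_zero] at h1
  simp [h1] at hk

/-- Polynomials whose expansion is invariant under the twists by `r`-th roots of unity. -/
def fixedSubalgebra (ξ : HahnSeries ℤ ℂ) (r : ℕ) : Subalgebra ℂ ℂ[X] where
  carrier := {p | ∀ ζ : ℂˣ, ζ ^ r = 1 → twist ζ ζ.ne_zero (expandAt ξ p) = expandAt ξ p}
  mul_mem' hp hq ζ hζ := by rw [map_mul, map_mul, hp ζ hζ, hq ζ hζ]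
  add_mem' hp hq ζ hζ := by rw [map_add, map_add, hp ζ hζ, hq ζ hζ]
  algebraMap_mem' c ζ _ := by
    rw [Polynomial.algebraMap_eq, expandAt_C, twist_C]

theorem fixedSubalgebra_mono {ξ : HahnSeries ℤ ℂ} {r s : ℕ} (h : r ∣ s) :
    fixedSubalgebra ξ s ≤ fixedSubalgebra ξ r := fun p hp ζ hζ => hp ζ (by
  obtain ⟨t, rfl⟩ := h
  rw [pow_mul, hζ, one_pow])

theorem comp_mem_subalgebra {S : Subalgebra ℂ ℂ[X]} {p : ℂ[X]} (hp : p ∈ S) (q : ℂ[X]) :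
    q.comp p ∈ S := by
  rw [Polynomial.comp_eq_aeval]
  exact Algebra.adjoin_le (Set.singleton_subset_iff.2 hp) (aeval_mem_adjoin_singleton ℂ p)

theorem exists_primitive_unit (r : ℕ) (hr : 0 < r) : ∃ ζ : ℂˣ, IsPrimitiveRoot ζ r := by
  have h := Complex.isPrimitiveRoot_exp r hr.ne'
  obtain ⟨u, hu⟩ := h.isUnit hr.ne'
  exact ⟨u, IsPrimitiveRoot.coe_units_iff.1 (hu ▸ h)⟩

theorem twist_lead_eq_iff {k r : ℕ} {ζ : ℂˣ} (hζ : IsPrimitiveRoot ζ r) :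
    ((ζ : ℂ) ^ (-(k : ℤ)) - 1 = 0) ↔ r ∣ k := by
  have h : ((ζ : ℂ) ^ (-(k : ℤ)) - 1 = 0) ↔ (ζ ^ k = 1) := by
    rw [sub_eq_zero, zpow_neg, inv_eq_one, zpow_natCast, ← Units.val_pow_eq_pow_val,
      Units.val_eq_one]
  rw [h, hζ.pow_eq_one_iff_dvd]

theorem dvd_natDegree_of_mem_fixed {ξ : HahnSeries ℤ ℂ} (hξ : HasLead 1 1 ξ) {r : ℕ} (hr : 0 < r)
    {p : ℂ[X]} (hp : p ∈ fixedSubalgebra ξ r) : r ∣ p.natDegree := by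
  obtain ⟨ζ, hζ⟩ := exists_primitive_unit r hr
  rcases eq_or_ne p 0 with rfl | h0
  · simp
  have h1 := hasLead_expandAt hξ p
  have h2 := h1.twist ζ ζ.ne_zero
  rw [hp ζ hζ.pow_eq_one] at h2
  have h3 := h2.unique h1
  rw [← twist_lead_eq_iff hζ]
  have h4 : ((ζ : ℂ) ^ (-(p.natDegree : ℤ)) - 1) * p.leadingCoeff = 0 := by
    rw [sub_mul, h3, one_mul, sub_self]
  exact (mul_eq_zero.1 h4).resolve_right (leadingCoeff_ne_zero.2 h0)

theorem mem_fixed_of_comp {ξ : HahnSeries ℤ ℂ} (hξ : HasLead 1 1 ξ) {a b : ℂ[X]} {n : ℕ}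
    (hab : 0 < (a.comp b).natDegree) (hn : (a.comp b).natDegree ∣ n)
    (h : expandAt ξ (a.comp b) = HahnSeries.single (-(n : ℤ)) 1) :
    b ∈ fixedSubalgebra ξ b.natDegree := by
  intro ζ hζ
  rw [natDegree_comp] at hab hn
  have ha := Nat.pos_of_mul_pos_right hab
  have hb := Nat.pos_of_mul_pos_left hab
  have hb0 : b ≠ 0 := ne_zero_of_natDegree_gt hb
  have h1 := hasLead_expandAt hξ b
  have h2 := h1.twist ζ ζ.ne_zero
  have h3 : ∀ k : ℕ, b.natDegree ∣ k → (ζ : ℂ) ^ (-(k : ℤ)) = 1 := by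
    rintro _ ⟨k, rfl⟩
    rw [zpow_neg, zpow_natCast, pow_mul, ← Units.val_pow_eq_pow_val, hζ]
    simp
  rw [h3 _ dvd_rfl, one_mul] at h2
  refine eval₂_eq_of_leads hb (leadingCoeff_ne_zero.2 hb0) h2 h1 a ha ?_
  rw [← twist_eval₂, ← expandAt_comp, h, twist_single, h3 _ ((dvd_mul_left _ _).trans hn), one_mul]

theorem exists_comp_of_subalgebra (S : Subalgebra ℂ ℂ[X]) {h : ℂ[X]} (hh : h ∈ S)
    (h0 : 0 < h.natDegree) (hdvd : ∀ p ∈ S, h.natDegree ∣ p.natDegree) (p : ℂ[X]) (hp : p ∈ S) :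
    ∃ q : ℂ[X], p = q.comp h := by
  induction hN : p.natDegree using Nat.strong_induction_on generalizing p with
  | _ N ih =>
    rcases Nat.eq_zero_or_pos N with rfl | hN0
    · exact ⟨C (p.coeff 0), by rw [C_comp]; exact eq_C_of_natDegree_eq_zero hN⟩
    obtain ⟨k, hk⟩ := hdvd p hp
    set c := p.leadingCoeff / h.leadingCoeff ^ k with hc
    have hl : h.leadingCoeff ≠ 0 := leadingCoeff_ne_zero.2 (ne_zero_of_natDegree_gt h0)
    have hp0 : p ≠ 0 := ne_zero_of_natDegree_gt (hN ▸ hN0)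
    have hc0 : c ≠ 0 := div_ne_zero (leadingCoeff_ne_zero.2 hp0) (pow_ne_zero _ hl)
    have hlt : (p - C c * h ^ k).natDegree < N := by
      have h1 : (p - C c * h ^ k).degree < p.degree := by
        refine degree_sub_lt_left ?_ hp0 ?_
        · rw [degree_C_mul hc0, degree_pow, degree_eq_natDegree hp0,
            degree_eq_natDegree (ne_zero_of_natDegree_gt h0), hk, mul_comm]
          push_cast
          simp
        · rw [leadingCoeff_mul, leadingCoeff_C, leadingCoeff_pow, hc, div_mul_cancel₀]
          exact pow_ne_zero _ hl
      rcases eq_or_ne (p - C c * h ^ k) 0 with h2 | h2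
      · rw [h2, natDegree_zero]; exact hN0
      · rw [← hN]; exact natDegree_lt_natDegree h2 h1
    obtain ⟨q, hq⟩ := ih _ hlt (p - C c * h ^ k)
      (S.sub_mem hp (S.mul_mem (S.algebraMap_mem c) (S.pow_mem hh k))) rfl
    exact ⟨q + C c * X ^ k, by simp [← hq]⟩

theorem coeff_X_sub_C_mul_eq {R : Type*} [CommRing R] (r : R) (p : R[X]) (j : ℕ) :
    ((X - C r) * p).coeff j = (X * p).coeff j - r * p.coeff j := by
  rw [sub_mul, coeff_sub, coeff_C_mul]

theorem hasLead_coeff_prod {ι : Type*} (s : Finset ι) (ρ : ι → HahnSeries ℤ ℂ) (c : ι → ℂ)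
    (h : ∀ i ∈ s, HasLead 1 (c i) (ρ i)) (j : ℕ) :
    ∃ e, HasLead s.card e ((∏ i ∈ s, (X - C (ρ i))).coeff j) := by
  classical
  induction s using Finset.induction_on generalizing j with
  | empty =>
    rw [Finset.prod_empty, coeff_one]
    split_ifs
    · exact ⟨1, by simpa using HasLead.const 1⟩
    · exact ⟨0, by simpa using HasLead.zero⟩
  | insert a s ha ih =>
    have ih' := ih fun i hi => h i (Finset.mem_insert_of_mem hi)
    have hX : ∃ e, HasLead (s.card + 1) e ((X * ∏ i ∈ s, (X - C (ρ i))).coeff j) := by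
      cases j with
      | zero => exact ⟨0, by simpa using HasLead.zero⟩
      | succ j =>
        obtain ⟨e, he⟩ := ih' j
        exact ⟨0, by rw [coeff_X_mul]; exact he.mono (Nat.lt_succ_self _)⟩
    obtain ⟨e₁, he₁⟩ := hX
    obtain ⟨e₂, he₂⟩ := ih' j
    have h3 := (h a (Finset.mem_insert_self a s)).mul he₂
    rw [add_comm] at h3
    refine ⟨e₁ - c a * e₂, ?_⟩
    rw [Finset.prod_insert ha, Finset.card_insert_of_notMem ha, coeff_X_sub_C_mul_eq]
    exact he₁.sub h3

section Roots

variable {E : Type*} [Field E] {ι : Type*}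

theorem isRoot_prod_X_sub_C_iff {s : ι → E} (hs : Function.Injective s) (J : Finset ι) (i : ι) :
    (∏ j ∈ J, (X - C (s j))).eval (s i) = 0 ↔ i ∈ J := by
  rw [eval_prod, Finset.prod_eq_zero_iff]
  constructor
  · rintro ⟨j, hj, h⟩
    rw [eval_sub, eval_X, eval_C, sub_eq_zero] at h
    exact hs h ▸ hj
  · exact fun h => ⟨i, h, by simp⟩

theorem monic_eq_prod_X_sub_C {s : ι → E} (hs : Function.Injective s) (J : Finset ι) {P : E[X]}
    (hP : P.Monic) (hdeg : P.natDegree = J.card) (hroot : ∀ i ∈ J, P.eval (s i) = 0) :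
    P = ∏ i ∈ J, (X - C (s i)) := by
  have hdvd : ∏ i ∈ J, (X - C (s i)) ∣ P :=
    Finset.prod_dvd_of_coprime (fun i _ j _ hij => pairwise_coprime_X_sub_C hs hij)
      fun i hi => dvd_iff_isRoot.2 (hroot i hi)
  refine (eq_of_monic_of_dvd_of_natDegree_le (monic_prod_of_monic _ _ fun i _ => monic_X_sub_C _)
    hP hdvd ?_)
  rw [hdeg, natDegree_prod_of_monic _ _ fun i _ => monic_X_sub_C _]
  simp

theorem monic_eq_prod_of_dvd_prod [DecidableEq ι] {s : ι → E} (hs : Function.Injective s)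
    (I J : Finset ι) (hJI : J ⊆ I) {g : E[X]} (hg : g.Monic) (hdvd : g ∣ ∏ i ∈ I, (X - C (s i)))
    (hroot : ∀ i ∈ I, g.eval (s i) = 0 ↔ i ∈ J) : g = ∏ i ∈ J, (X - C (s i)) := by
  have h1 : ∏ i ∈ J, (X - C (s i)) ∣ g :=
    Finset.prod_dvd_of_coprime (fun i _ j _ hij => pairwise_coprime_X_sub_C hs hij)
      fun i hi => dvd_iff_isRoot.2 ((hroot i (hJI hi)).2 hi)
  have h2 : g ∣ ∏ i ∈ J, (X - C (s i)) := by
    rw [← Finset.prod_sdiff hJI] at hdvd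
    refine IsCoprime.dvd_of_dvd_mul_left ?_ hdvd
    refine IsCoprime.prod_right fun i hi => ?_
    rw [Finset.mem_sdiff] at hi
    refine ((irreducible_X_sub_C _).coprime_iff_not_dvd.2 fun h => hi.2 ?_).symm
    exact (hroot i hi.1).1 (dvd_iff_isRoot.1 h)
  exact eq_of_monic_of_associated hg (monic_prod_of_monic _ _ fun i _ => monic_X_sub_C _)
    (associated_of_dvd_dvd h2 h1)

theorem exists_map_eq_prod_inter [DecidableEq ι] {R : Type*} [CommRing R] [IsDomain R]
    [IsIntegrallyClosed R] (φ : R →+* E) (hφ : Function.Injective φ) {P Q : R[X]} (hPm : P.Monic)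
    {s : ι → E} (hs : Function.Injective s) (A B : Finset ι)
    (hP : P.map φ = ∏ i ∈ A, (X - C (s i))) (hQ : Q.map φ = ∏ i ∈ B, (X - C (s i))) :
    ∃ g : R[X], g.map φ = ∏ i ∈ A ∩ B, (X - C (s i)) := by
  classical
  let K := FractionRing R
  let ψ : K →+* E := IsFractionRing.lift hφ
  have hψ : ψ.comp (algebraMap R K) = φ := RingHom.ext fun x => IsFractionRing.lift_algebraMap hφ x
  set g₀ := EuclideanDomain.gcd (P.map (algebraMap R K)) (Q.map (algebraMap R K)) with hg₀
  obtain ⟨g, hg⟩ := IsIntegrallyClosed.eq_map_mul_C_of_dvd K hPm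
    (EuclideanDomain.gcd_dvd_left (P.map (algebraMap R K)) (Q.map (algebraMap R K)))
  rw [← hg₀] at hg
  have hg₀dvd : g₀ ∣ P.map (algebraMap R K) := EuclideanDomain.gcd_dvd_left _ _
  have hg₀0 : g₀ ≠ 0 := fun h => (hPm.map (algebraMap R K)).ne_zero (by
    rw [h, zero_dvd_iff] at hg₀dvd
    exact hg₀dvd)
  have hlc : g₀.leadingCoeff ≠ 0 := leadingCoeff_ne_zero.2 hg₀0
  have hgm : (g.map (algebraMap R K)).Monic := by
    have := congrArg leadingCoeff hg
    rw [leadingCoeff_mul, leadingCoeff_C] at this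
    exact mul_right_cancel₀ hlc (this.trans (one_mul _).symm)
  have hmapg : (g.map (algebraMap R K)).map ψ = g.map φ := by rw [map_map, hψ]
  have hmapP : (P.map (algebraMap R K)).map ψ = P.map φ := by rw [map_map, hψ]
  have hmapQ : (Q.map (algebraMap R K)).map ψ = Q.map φ := by rw [map_map, hψ]
  refine ⟨g, monic_eq_prod_of_dvd_prod hs A _ Finset.inter_subset_left
    (hmapg ▸ hgm.map ψ) ?_ fun i hi => ?_⟩
  · rw [← hP, ← hmapg, ← hmapP]
    refine map_dvd (mapRingHom ψ) ?_
    exact (Dvd.intro _ hg).trans hg₀dvd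
  · have h1 : (g.map φ).eval (s i) = 0 ↔ eval₂ ψ (s i) g₀ = 0 := by
      rw [← hg, eval₂_mul, eval₂_C, ← hmapg, eval_map]
      simp [hlc]
    rw [h1, hg₀, root_gcd_iff_root_left_right, ← eval_map, ← eval_map, hmapP, hmapQ, hP, hQ,
      isRoot_prod_X_sub_C_iff hs, isRoot_prod_X_sub_C_iff hs, Finset.mem_inter]

end Roots

/-- The group of `r`-th roots of unity, as a finset. -/
def unitRoots (r : ℕ) [NeZero r] : Finset ℂˣ :=
  (Set.finite_coe_iff.1 (inferInstance : Finite (rootsOfUnity r ℂ))).toFinset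

theorem mem_unitRoots {r : ℕ} [NeZero r] {ζ : ℂˣ} : ζ ∈ unitRoots r ↔ ζ ^ r = 1 := by
  simp [unitRoots, mem_rootsOfUnity]

theorem card_unitRoots (r : ℕ) [NeZero r] : (unitRoots r).card = r := by
  rw [unitRoots, ← Set.ncard_eq_toFinset_card _ (Set.finite_coe_iff.1 (inferInstance : Finite (rootsOfUnity r ℂ))),
    ← Nat.card_coe_set_eq]
  exact Complex.card_rootsOfUnity r

theorem twist_twist (ζ η : ℂˣ) (u : HahnSeries ℤ ℂ) :
    twist ζ ζ.ne_zero (twist η η.ne_zero u) = twist (ζ * η : ℂˣ) (ζ * η).ne_zero u := by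
  ext k
  simp only [coeff_twist, Units.val_mul, mul_zpow]
  ring

theorem twist_injective {ξ : HahnSeries ℤ ℂ} (hξ : HasLead 1 1 ξ) :
    Function.Injective fun ζ : ℂˣ => twist ζ ζ.ne_zero ξ := by
  intro ζ η h
  have h1 := congrArg (fun u => HahnSeries.coeff u (-1)) h
  simp only [coeff_twist] at h1
  have h2 : ξ.coeff (-1) = 1 := by simpa using hξ.coeff_eq
  rw [h2, mul_one, mul_one, zpow_neg_one, zpow_neg_one] at h1
  exact Units.ext (inv_injective h1)

theorem map_eq_prod_twist {ξ : HahnSeries ℤ ℂ} (hξ : HasLead 1 1 ξ) {b : ℂ[X]} (hb : b.Monic)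
    (hb0 : 0 < b.natDegree) [NeZero b.natDegree] (hfix : b ∈ fixedSubalgebra ξ b.natDegree) :
    (b.map C - C b).Monic ∧ (b.map C - C b).map (expandAt ξ) =
      ∏ ζ ∈ unitRoots b.natDegree, (X - C (twist ζ ζ.ne_zero ξ)) := by
  have hdeg : (C b : ℂ[X][X]).degree < (b.map C : ℂ[X][X]).degree := by
    refine degree_C_le.trans_lt ?_
    rw [degree_map_eq_of_injective C_injective]
    exact natDegree_pos_iff_degree_pos.1 hb0
  have hm : (b.map C - C b).Monic := (hb.map C).sub_of_left hdeg
  refine ⟨hm, monic_eq_prod_X_sub_C (twist_injective hξ) _ (hm.map _) ?_ fun ζ hζ => ?_⟩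
  · rw [hm.natDegree_map, card_unitRoots, natDegree_sub_C,
      natDegree_map_eq_of_injective C_injective]
  · rw [eval_map, eval₂_sub, eval₂_C, eval₂_map]
    have h1 : (expandAt ξ).comp C = HahnSeries.C := RingHom.ext fun c => expandAt_C ξ c
    rw [h1, ← twist_eval₂, sub_eq_zero]
    exact hfix ζ (mem_unitRoots.1 hζ)

theorem exists_mem_fixed_gcd {ξ : HahnSeries ℤ ℂ} (hξ : HasLead 1 1 ξ) {b d : ℂ[X]}
    (hb : b.Monic) (hd : d.Monic) (hb0 : 0 < b.natDegree) (hd0 : 0 < d.natDegree)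
    (hbfix : b ∈ fixedSubalgebra ξ b.natDegree) (hdfix : d ∈ fixedSubalgebra ξ d.natDegree) :
    ∃ h ∈ fixedSubalgebra ξ (Nat.gcd b.natDegree d.natDegree),
      h.natDegree = Nat.gcd b.natDegree d.natDegree := by
  classical
  set r := Nat.gcd b.natDegree d.natDegree with hr
  have hr0 : 0 < r := Nat.gcd_pos_of_pos_left _ hb0
  have : NeZero b.natDegree := ⟨hb0.ne'⟩
  have : NeZero d.natDegree := ⟨hd0.ne'⟩
  have : NeZero r := ⟨hr0.ne'⟩
  obtain ⟨hPm, hP⟩ := map_eq_prod_twist hξ hb hb0 hbfix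
  obtain ⟨-, hQ⟩ := map_eq_prod_twist hξ hd hd0 hdfix
  have hinj := twist_injective hξ
  obtain ⟨g, hg⟩ := exists_map_eq_prod_inter (expandAt ξ) (expandAt_injective hξ) hPm hinj _ _ hP hQ
  have hinter : unitRoots b.natDegree ∩ unitRoots d.natDegree = unitRoots r := by
    ext ζ
    rw [Finset.mem_inter, mem_unitRoots, mem_unitRoots, mem_unitRoots, ← orderOf_dvd_iff_pow_eq_one,
      ← orderOf_dvd_iff_pow_eq_one, ← orderOf_dvd_iff_pow_eq_one, hr, Nat.dvd_gcd_iff]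
  rw [hinter] at hg
  have hcoeff : ∀ i, expandAt ξ (g.coeff i) =
      (∏ ζ ∈ unitRoots r, (X - C (twist ζ ζ.ne_zero ξ))).coeff i := fun i => by
    rw [← hg, coeff_map]
  have hfix : ∀ i, g.coeff i ∈ fixedSubalgebra ξ r := by
    intro i η hη
    rw [hcoeff, ← coeff_map, Polynomial.map_prod]
    congr 1
    refine Finset.prod_bij (fun ζ _ => η * ζ) (fun ζ hζ => ?_) (fun ζ _ ζ' _ h => mul_left_cancel h)
      (fun ζ hζ => ⟨η⁻¹ * ζ, ?_, mul_inv_cancel_left η ζ⟩) fun ζ hζ => ?_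
    · rw [mem_unitRoots] at hζ ⊢
      rw [mul_pow, hη, hζ, one_mul]
    · rw [mem_unitRoots] at hζ ⊢
      rw [mul_pow, inv_pow, hη, hζ, inv_one, one_mul]
    · rw [Polynomial.map_sub, map_X, map_C, twist_twist]
  have hle : ∀ i, (g.coeff i).natDegree ≤ r := by
    intro i
    obtain ⟨e, he⟩ := hasLead_coeff_prod (unitRoots r) (fun ζ => twist ζ ζ.ne_zero ξ) _
      (fun ζ _ => hξ.twist ζ ζ.ne_zero) i
    rw [card_unitRoots, ← hcoeff] at he
    exact natDegree_le_of_hasLead hξ he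
  by_contra! hcon
  have hconst : ∀ i, (g.coeff i).natDegree = 0 := by
    intro i
    have h1 := dvd_natDegree_of_mem_fixed hξ hr0 (hfix i)
    rcases Nat.eq_zero_or_pos (g.coeff i).natDegree with h0 | h0
    · exact h0
    · exact absurd (le_antisymm (hle i) (Nat.le_of_dvd h0 h1)) (hcon _ (hfix i))
  have heval : g.eval X = 0 := by
    refine expandAt_injective hξ ?_
    rw [map_zero]
    have h1 : (g.map (expandAt ξ)).eval (expandAt ξ X) = 0 := by
      rw [hg, expandAt_X]
      have := (isRoot_prod_X_sub_C_iff hinj (unitRoots r) 1).2 (mem_unitRoots.2 (one_pow r))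
      have h2 : twist ((1 : ℂˣ) : ℂ) (1 : ℂˣ).ne_zero ξ = ξ := by
        ext k
        simp [coeff_twist]
      rwa [h2] at this
    rwa [eval_map, eval₂_hom] at h1
  have hg0 : g ≠ 0 := by
    rintro rfl
    rw [Polynomial.map_zero] at hg
    exact (monic_prod_of_monic _ _ fun i _ => monic_X_sub_C _).ne_zero hg.symm
  have hgC : g = (g.map (evalRingHom 0)).map C := by
    ext1 i
    rw [coeff_map, coeff_map, coe_evalRingHom, ← coeff_zero_eq_eval_zero]
    exact eq_C_of_natDegree_eq_zero (hconst i)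
  rw [hgC, eval_map] at heval
  refine hg0 ?_
  rw [hgC]
  have : eval₂ C X (g.map (evalRingHom 0)) = g.map (evalRingHom 0) := eval₂_C_X
  rw [← this, heval, Polynomial.map_zero]

theorem exists_expansion_fixing (f : ℂ[X]) (hf : 0 < f.natDegree) :
    ∃ ξ : HahnSeries ℤ ℂ, HasLead 1 1 ξ ∧
      ∀ a b : ℂ[X], f = a.comp b → b ∈ fixedSubalgebra ξ b.natDegree := by
  have hf0 : f ≠ 0 := ne_zero_of_natDegree_gt hf
  have hκ : f.leadingCoeff⁻¹ ≠ 0 := inv_ne_zero (leadingCoeff_ne_zero.2 hf0)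
  have hm : (C f.leadingCoeff⁻¹ * f).Monic := by
    rw [mul_comm]
    exact monic_mul_leadingCoeff_inv hf0
  have hdeg : (C f.leadingCoeff⁻¹ * f).natDegree = f.natDegree := natDegree_C_mul hκ
  obtain ⟨ξ, hξ, h⟩ := exists_expansion _ hm (by rwa [hdeg])
  refine ⟨ξ, hξ, ?_⟩
  rintro a b rfl
  have hcomp : C (a.comp b).leadingCoeff⁻¹ * a.comp b =
      (C (a.comp b).leadingCoeff⁻¹ * a).comp b := by rw [mul_comp, C_comp]
  rw [← expandAt_apply, hcomp] at h
  rw [hcomp] at hdeg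
  exact mem_fixed_of_comp hξ (by rwa [hdeg]) dvd_rfl h

theorem exists_right_gcd {a b c d : ℂ[X]} (h : a.comp b = c.comp d)
    (h0 : 0 < (a.comp b).natDegree) :
    ∃ e b' d' : ℂ[X], b = b'.comp e ∧ d = d'.comp e ∧
      e.natDegree = Nat.gcd b.natDegree d.natDegree := by
  obtain ⟨ξ, hξ, hfix⟩ := exists_expansion_fixing _ h0
  have hb := hfix a b rfl
  have hd := hfix c d h
  have hb0 : 0 < b.natDegree := by
    rw [natDegree_comp] at h0
    exact Nat.pos_of_mul_pos_left h0
  have hd0 : 0 < d.natDegree := by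
    rw [h, natDegree_comp] at h0
    exact Nat.pos_of_mul_pos_left h0
  have norm : ∀ p : ℂ[X], 0 < p.natDegree → p ∈ fixedSubalgebra ξ p.natDegree →
      ∃ q : ℂ[X], q.Monic ∧ q.natDegree = p.natDegree ∧ q ∈ fixedSubalgebra ξ q.natDegree := by
    intro p hp hfix
    have hl := leadingCoeff_ne_zero.2 (ne_zero_of_natDegree_gt hp)
    have hdeg : (C p.leadingCoeff⁻¹ * p).natDegree = p.natDegree :=
      natDegree_C_mul (inv_ne_zero hl)
    refine ⟨C p.leadingCoeff⁻¹ * p, ?_, hdeg, ?_⟩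
    · rw [mul_comm]
      exact monic_mul_leadingCoeff_inv (ne_zero_of_natDegree_gt hp)
    · rw [hdeg]
      exact Subalgebra.mul_mem _ (Subalgebra.algebraMap_mem _ _) hfix
  obtain ⟨b₁, hb₁m, hb₁d, hb₁⟩ := norm b hb0 hb
  obtain ⟨d₁, hd₁m, hd₁d, hd₁⟩ := norm d hd0 hd
  obtain ⟨e, he, hed⟩ := exists_mem_fixed_gcd hξ hb₁m hd₁m (by rwa [hb₁d]) (by rwa [hd₁d]) hb₁ hd₁
  rw [hb₁d, hd₁d] at he hed
  have hr0 : 0 < Nat.gcd b.natDegree d.natDegree := Nat.gcd_pos_of_pos_left _ hb0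
  have hall := exists_comp_of_subalgebra _ he (hed ▸ hr0)
    fun p hp => hed ▸ dvd_natDegree_of_mem_fixed hξ hr0 hp
  obtain ⟨b', hb'⟩ := hall b (fixedSubalgebra_mono (Nat.gcd_dvd_left _ _) hb)
  obtain ⟨d', hd'⟩ := hall d (fixedSubalgebra_mono (Nat.gcd_dvd_right _ _) hd)
  exact ⟨e, b', d', hb', hd', hed⟩

/-- The degree of an element of `ℂ[b] + ℂ[d]` is a multiple of `deg b` or of `deg d`. -/
theorem dvd_natDegree_sub {ξ : HahnSeries ℤ ℂ} (hξ : HasLead 1 1 ξ) {r s : ℕ}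
    (hr : 0 < r) (hs : 0 < s) {p q : ℂ[X]} (hp : p ∈ fixedSubalgebra ξ r)
    (hq : q ∈ fixedSubalgebra ξ s) (hpq : p - q ≠ 0) :
    r ∣ (p - q).natDegree ∨ s ∣ (p - q).natDegree := by
  obtain ⟨ζ, hζ⟩ := exists_primitive_unit r hr
  obtain ⟨η, hη⟩ := exists_primitive_unit s hs
  set k := (p - q).natDegree
  set l := (p - q).leadingCoeff with hl
  have h1 : HasLead k l (expandAt ξ (p - q)) := hasLead_expandAt hξ (p - q)
  have h2 := (h1.twist ζ ζ.ne_zero).sub h1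
  have h3 := (h2.twist η η.ne_zero).sub h2
  have hcomm : ∀ u, twist ζ ζ.ne_zero (twist η η.ne_zero u) =
      twist η η.ne_zero (twist ζ ζ.ne_zero u) := fun u => by
    rw [twist_twist, twist_twist]
    simp only [mul_comm]
  have hzero : twist η η.ne_zero (twist ζ ζ.ne_zero (expandAt ξ (p - q)) - expandAt ξ (p - q)) -
      (twist ζ ζ.ne_zero (expandAt ξ (p - q)) - expandAt ξ (p - q)) = 0 := by
    rw [(expandAt ξ).map_sub, (twist ζ ζ.ne_zero).map_sub, hp ζ hζ.pow_eq_one,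
      show expandAt ξ p - twist ζ ζ.ne_zero (expandAt ξ q) - (expandAt ξ p - expandAt ξ q) =
        expandAt ξ q - twist ζ ζ.ne_zero (expandAt ξ q) by ring, (twist η η.ne_zero).map_sub,
      ← hcomm, hq η hη.pow_eq_one]
    ring
  rw [hzero] at h3
  have h4 := h3.coeff_eq
  rw [HahnSeries.coeff_zero] at h4
  have h5 : ((η : ℂ) ^ (-(k : ℤ)) - 1) * (((ζ : ℂ) ^ (-(k : ℤ)) - 1) * l) = 0 := by
    rw [h4]
    ring
  rcases mul_eq_zero.1 h5 with h6 | h6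
  · exact Or.inr ((twist_lead_eq_iff hη).1 h6)
  · rcases mul_eq_zero.1 h6 with h7 | h7
    · exact Or.inl ((twist_lead_eq_iff hζ).1 h7)
    · exact absurd (leadingCoeff_eq_zero.1 h7) hpq

theorem natDegree_sub_C_mul_pow_lt {p b : ℂ[X]} {k : ℕ} (hb : 0 < b.natDegree) (hp : p ≠ 0)
    (hk : p.natDegree = b.natDegree * k) :
    ∃ c : ℂ, p - C c * b ^ k = 0 ∨ (p - C c * b ^ k).natDegree < p.natDegree := by
  have hb0 : b ≠ 0 := ne_zero_of_natDegree_gt hb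
  have hl : b.leadingCoeff ≠ 0 := leadingCoeff_ne_zero.2 hb0
  have hc0 : p.leadingCoeff / b.leadingCoeff ^ k ≠ 0 :=
    div_ne_zero (leadingCoeff_ne_zero.2 hp) (pow_ne_zero _ hl)
  refine ⟨p.leadingCoeff / b.leadingCoeff ^ k, ?_⟩
  refine or_iff_not_imp_left.2 fun h => natDegree_lt_natDegree h (degree_sub_lt_left ?_ hp ?_)
  · rw [degree_C_mul hc0, degree_pow, degree_eq_natDegree hp, degree_eq_natDegree hb0, hk, mul_comm]
    push_cast
    simp
  · rw [leadingCoeff_mul, leadingCoeff_C, leadingCoeff_pow, div_mul_cancel₀]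
    exact pow_ne_zero _ hl

theorem exists_left_lcm {a b c d : ℂ[X]} (h : a.comp b = c.comp d)
    (h0 : 0 < (a.comp b).natDegree) :
    ∃ E e p q : ℂ[X], e = p.comp b ∧ e = q.comp d ∧ a.comp b = E.comp e ∧
      e.natDegree = Nat.lcm b.natDegree d.natDegree := by
  obtain ⟨ξ, hξ, hfix⟩ := exists_expansion_fixing _ h0
  have hb := hfix a b rfl
  have hd := hfix c d h
  have hb0 : 0 < b.natDegree := by
    rw [natDegree_comp] at h0
    exact Nat.pos_of_mul_pos_left h0
  have hd0 : 0 < d.natDegree := by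
    rw [h, natDegree_comp] at h0
    exact Nat.pos_of_mul_pos_left h0
  set m := Nat.lcm b.natDegree d.natDegree with hm
  have hm0 : 0 < m := Nat.lcm_pos hb0 hd0
  obtain ⟨s, hs⟩ : b.natDegree ∣ m := Nat.dvd_lcm_left _ _
  obtain ⟨t, ht⟩ : d.natDegree ∣ m := Nat.dvd_lcm_right _ _
  have key : ∀ N : ℕ, ∀ p q : ℂ[X], (p.comp b).natDegree = m → (q.comp d).natDegree = m →
      p.comp b - q.comp d ≠ 0 → (p.comp b - q.comp d).natDegree = N → N < m →
      ∃ p q : ℂ[X], (p.comp b).natDegree = m ∧ p.comp b = q.comp d := by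
    intro N
    induction N using Nat.strong_induction_on with
    | _ N ih =>
      intro p q hp hq hne hN hNm
      have step : ∀ p' q' : ℂ[X], (p'.comp b).natDegree = m → (q'.comp d).natDegree = m →
          (p'.comp b - q'.comp d = 0 ∨ (p'.comp b - q'.comp d).natDegree < N) →
          ∃ p q : ℂ[X], (p.comp b).natDegree = m ∧ p.comp b = q.comp d := by
        intro p' q' hp' hq' hor
        by_cases hz : p'.comp b - q'.comp d = 0
        · exact ⟨p', q', hp', sub_eq_zero.1 hz⟩
        · have := hor.resolve_left hz
          exact ih _ this p' q' hp' hq' hz rfl (this.trans hNm)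
      rcases dvd_natDegree_sub hξ hb0 hd0 (comp_mem_subalgebra hb p) (comp_mem_subalgebra hd q) hne
        with ⟨k, hk⟩ | ⟨k, hk⟩
      · obtain ⟨c, hc⟩ := natDegree_sub_C_mul_pow_lt hb0 hne hk
        have h1 : (p - C c * X ^ k).comp b - q.comp d = p.comp b - q.comp d - C c * b ^ k := by
          simp
          ring
        refine step (p - C c * X ^ k) q ?_ hq (by rw [h1, ← hN]; exact hc)
        rw [sub_comp, mul_comp, C_comp, X_pow_comp, natDegree_sub_eq_left_of_natDegree_lt, hp]
        refine (natDegree_C_mul_le _ _).trans_lt ?_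
        rw [natDegree_pow, mul_comm, ← hk, hN, hp]
        exact hNm
      · obtain ⟨c, hc⟩ := natDegree_sub_C_mul_pow_lt hd0 hne hk
        have h1 : p.comp b - (q + C c * X ^ k).comp d = p.comp b - q.comp d - C c * d ^ k := by
          simp
          ring
        refine step p (q + C c * X ^ k) hp ?_ (by rw [h1, ← hN]; exact hc)
        rw [add_comp, mul_comp, C_comp, X_pow_comp, natDegree_add_eq_left_of_natDegree_lt, hq]
        refine (natDegree_C_mul_le _ _).trans_lt ?_
        rw [natDegree_pow, mul_comm, ← hk, hN, hq]
        exact hNm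
  have hex : ∃ p q : ℂ[X], (p.comp b).natDegree = m ∧ p.comp b = q.comp d := by
    have hbl := leadingCoeff_ne_zero.2 (ne_zero_of_natDegree_gt hb0)
    have hdl := leadingCoeff_ne_zero.2 (ne_zero_of_natDegree_gt hd0)
    have hp : ((X ^ s : ℂ[X]).comp b).natDegree = m := by simp [hs, mul_comm]
    have hp0 : (X ^ s : ℂ[X]).comp b ≠ 0 := ne_zero_of_natDegree_gt (hp ▸ hm0)
    obtain ⟨c, hc⟩ := natDegree_sub_C_mul_pow_lt hd0 hp0 (hp.trans ht)
    have h1 : (X ^ s : ℂ[X]).comp b - (C c * X ^ t).comp d =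
      (X ^ s : ℂ[X]).comp b - C c * d ^ t := by simp
    rw [← h1, hp] at hc
    by_cases hz : (X ^ s : ℂ[X]).comp b - (C c * X ^ t).comp d = 0
    · exact ⟨_, _, hp, sub_eq_zero.1 hz⟩
    · have hlt := hc.resolve_left hz
      refine key _ _ _ hp ?_ hz rfl hlt
      rw [← hp] at hlt ⊢
      by_contra hne
      rcases lt_or_gt_of_ne hne with h2 | h2
      · rw [natDegree_sub_eq_left_of_natDegree_lt h2] at hlt
        exact lt_irrefl _ hlt
      · rw [natDegree_sub_eq_right_of_natDegree_lt h2] at hlt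
        exact lt_asymm h2 hlt
  obtain ⟨p, q, hpd, hpq⟩ := hex
  have hmem : ∀ (u v : ℂ[X]), u ∈ (aeval v : ℂ[X] →ₐ[ℂ] ℂ[X]).range ↔ ∃ w : ℂ[X], u = w.comp v := by
    intro u v
    rw [AlgHom.mem_range]
    simp only [← Polynomial.comp_eq_aeval, eq_comm]
  obtain ⟨E, hE⟩ := exists_comp_of_subalgebra
    ((aeval b : ℂ[X] →ₐ[ℂ] ℂ[X]).range ⊓ (aeval d : ℂ[X] →ₐ[ℂ] ℂ[X]).range) (h := p.comp b)
    ⟨(hmem _ _).2 ⟨p, rfl⟩, (hmem _ _).2 ⟨q, hpq⟩⟩ (hpd ▸ hm0) (by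
      rintro u ⟨hu, hu'⟩
      obtain ⟨w, hw⟩ := (hmem _ _).1 hu
      obtain ⟨w', hw'⟩ := (hmem _ _).1 hu'
      rw [hpd]
      refine Nat.lcm_dvd ?_ ?_
      · rw [hw, natDegree_comp]
        exact dvd_mul_left _ _
      · rw [hw', natDegree_comp]
        exact dvd_mul_left _ _) (a.comp b)
    ⟨(hmem _ _).2 ⟨a, rfl⟩, (hmem _ _).2 ⟨c, h⟩⟩
  exact ⟨E, p.comp b, p, q, rfl, hpq, hE, hpd⟩

namespace IsLinearPoly

theorem X : IsLinearPoly (X : ℂ[X]) := natDegree_X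

theorem comp {L M : ℂ[X]} (hL : IsLinearPoly L) (hM : IsLinearPoly M) :
    IsLinearPoly (L.comp M) := by
  rw [IsLinearPoly, natDegree_comp, hL, hM]

theorem natDegree_comp_left {L : ℂ[X]} (hL : IsLinearPoly L) (p : ℂ[X]) :
    (L.comp p).natDegree = p.natDegree := by
  rw [natDegree_comp, hL, one_mul]

theorem natDegree_comp_right {L : ℂ[X]} (hL : IsLinearPoly L) (p : ℂ[X]) :
    (p.comp L).natDegree = p.natDegree := by
  rw [natDegree_comp, hL, mul_one]

theorem C_mul_X_add_C {a : ℂ} (ha : a ≠ 0) (b : ℂ) : IsLinearPoly (C a * Polynomial.X + C b) :=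
  natDegree_linear ha

theorem exists_eq {L : ℂ[X]} (hL : IsLinearPoly L) :
    ∃ a b : ℂ, a ≠ 0 ∧ L = C a * Polynomial.X + C b := by
  obtain ⟨a, ha, b, h⟩ := natDegree_eq_one.1 hL
  exact ⟨a, b, ha, h.symm⟩

theorem exists_inverse {L : ℂ[X]} (hL : IsLinearPoly L) :
    ∃ M : ℂ[X], IsLinearPoly M ∧ L.comp M = Polynomial.X ∧ M.comp L = Polynomial.X := by
  obtain ⟨a, b, ha, rfl⟩ := hL.exists_eq
  refine ⟨C a⁻¹ * Polynomial.X + C (-(a⁻¹ * b)), C_mul_X_add_C (inv_ne_zero ha) _, ?_, ?_⟩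
  · simp only [add_comp, mul_comp, C_comp, X_comp, mul_add, ← mul_assoc, ← C_mul, mul_neg,
      mul_inv_cancel₀ ha, C_neg]
    simp
  · simp only [add_comp, mul_comp, C_comp, X_comp, mul_add, ← mul_assoc, ← C_mul,
      inv_mul_cancel₀ ha, C_neg]
    simp

end IsLinearPoly

theorem comp_right_cancel {p q r : ℂ[X]} (hr : 0 < r.natDegree) (h : p.comp r = q.comp r) :
    p = q := by
  have h1 : (p - q).comp r = 0 := by rw [sub_comp, h, sub_self]
  rw [comp_eq_zero_iff] at h1
  rcases h1 with h1 | ⟨-, h1⟩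
  · exact sub_eq_zero.1 h1
  · rw [h1, natDegree_C] at hr
    exact absurd hr (lt_irrefl 0)

namespace Indecomposable

theorem comp_left {L p : ℂ[X]} (hL : IsLinearPoly L) (hp : Indecomposable p) :
    Indecomposable (L.comp p) := by
  obtain ⟨M, hM, -, hML⟩ := hL.exists_inverse
  refine ⟨by rw [hL.natDegree_comp_left]; exact hp.1, ?_⟩
  rintro ⟨g, h, hg, hh, hgh⟩
  refine hp.2 ⟨M.comp g, h, by rwa [hM.natDegree_comp_left], hh, ?_⟩
  rw [comp_assoc, ← hgh, ← comp_assoc, hML, X_comp]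

theorem comp_right {L p : ℂ[X]} (hL : IsLinearPoly L) (hp : Indecomposable p) :
    Indecomposable (p.comp L) := by
  obtain ⟨M, hM, hLM, -⟩ := hL.exists_inverse
  refine ⟨by rw [hL.natDegree_comp_right]; exact hp.1, ?_⟩
  rintro ⟨g, h, hg, hh, hgh⟩
  refine hp.2 ⟨g, h.comp M, hg, by rwa [hM.natDegree_comp_right], ?_⟩
  rw [← comp_assoc, ← hgh, comp_assoc, hLM, comp_X]

theorem natDegree_pos {p : ℂ[X]} (hp : Indecomposable p) : 0 < p.natDegree :=
  zero_lt_two.trans_le hp.1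

/-- A decomposition of an indecomposable polynomial has a linear factor. -/
theorem eq_one_of_comp {p g h : ℂ[X]} (hp : Indecomposable p) (hgh : p = g.comp h) :
    g.natDegree = 1 ∨ h.natDegree = 1 := by
  by_contra! hcon
  have h1 := hp.natDegree_pos
  rw [hgh, natDegree_comp] at h1
  have h2 := Nat.pos_of_mul_pos_right h1
  have h3 := Nat.pos_of_mul_pos_left h1
  exact hp.2 ⟨g, h, by omega, by omega, hgh⟩

end Indecomposable

theorem exists_linear_of_natDegree_eq {a b c d : ℂ[X]} (h : a.comp b = c.comp d)
    (h0 : 0 < (a.comp b).natDegree) (hbd : b.natDegree = d.natDegree) :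
    ∃ L : ℂ[X], IsLinearPoly L ∧ d = L.comp b := by
  obtain ⟨e, b', d', hb, hd, he⟩ := exists_right_gcd h h0
  have hb0 : 0 < b.natDegree := by
    rw [natDegree_comp] at h0
    exact Nat.pos_of_mul_pos_left h0
  rw [← hbd, Nat.gcd_self] at he
  have h1 : b'.natDegree = 1 := by
    have := congrArg natDegree hb
    rw [natDegree_comp, he] at this
    exact Nat.eq_of_mul_eq_mul_right hb0 (by rw [← this, one_mul])
  have h2 : d'.natDegree = 1 := by
    have := congrArg natDegree hd
    rw [natDegree_comp, he, ← hbd] at this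
    exact Nat.eq_of_mul_eq_mul_right hb0 (by rw [← this, one_mul])
  obtain ⟨M, hM, -, hMb⟩ := IsLinearPoly.exists_inverse h1
  refine ⟨d'.comp M, IsLinearPoly.comp h2 hM, ?_⟩
  conv_rhs => rw [hb]
  rw [comp_assoc, ← comp_assoc M, hMb, X_comp, ← hd]

/-- Two right factors of the same polynomial, the first of which is indecomposable, are either
linearly related or of coprime degrees, provided the second is indecomposable too. -/
theorem coprime_or_linear {a b c d : ℂ[X]} (h : a.comp b = c.comp d)
    (h0 : 0 < (a.comp b).natDegree) (hb : Indecomposable b) (hd : Indecomposable d) :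
    Nat.Coprime b.natDegree d.natDegree ∨ ∃ L : ℂ[X], IsLinearPoly L ∧ d = L.comp b := by
  obtain ⟨e, b', d', hbe, hde, he⟩ := exists_right_gcd h h0
  rcases hb.eq_one_of_comp hbe with h1 | h1
  · rcases hd.eq_one_of_comp hde with h2 | h2
    · right
      refine exists_linear_of_natDegree_eq h h0 ?_
      rw [hbe, hde, natDegree_comp, natDegree_comp, h1, h2]
    · exact Or.inl (he.symm.trans h2)
  · exact Or.inl (he.symm.trans h1)

theorem indecomposable_of_cross {p a q b : ℂ[X]} (h : p.comp a = q.comp b) (ha : Indecomposable a)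
    (hq : q.natDegree = a.natDegree) (hp : 0 < p.natDegree)
    (hcop : Nat.Coprime a.natDegree b.natDegree) : Indecomposable q := by
  refine ⟨hq ▸ ha.1, ?_⟩
  rintro ⟨g, k, hg, hk, rfl⟩
  rw [comp_assoc] at h
  obtain ⟨e, a', -, ha', -, he⟩ := exists_right_gcd h
    (by rw [natDegree_comp]; exact Nat.mul_pos hp ha.natDegree_pos)
  rw [natDegree_comp] at hq
  have hek : e.natDegree = k.natDegree := by
    rw [he, natDegree_comp, Nat.Coprime.gcd_mul_right_cancel_right _ hcop.symm, ← hq,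
      Nat.gcd_mul_left_left]
  refine ha.2 ⟨a', e, ?_, hek ▸ hk, ha'⟩
  have h2 := congrArg natDegree ha'
  rw [natDegree_comp, ← hq, hek] at h2
  exact (Nat.eq_of_mul_eq_mul_right (by omega) h2) ▸ hg

theorem leadingCoeff_sub_C {p : ℂ[X]} (hp : 0 < p.natDegree) (x : ℂ) :
    (p - C x).leadingCoeff = p.leadingCoeff := by
  rw [leadingCoeff, natDegree_sub_C, coeff_sub, coeff_C, if_neg hp.ne', sub_zero, leadingCoeff]

theorem resultant_eq_prod_eval_of_natDegree_eq {f g : ℂ[X]} {m n : ℕ} (hf : f.natDegree = n)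
    (hg : g.natDegree ≤ m) :
    f.resultant g n m = f.leadingCoeff ^ m * (f.roots.map fun x => g.eval x).prod := by
  subst hf
  exact resultant_eq_prod_eval f g m hg (IsAlgClosed.splits f)

theorem eq_zero_of_sum_comp_mul_pow_eq_zero {b d : ℂ[X]}
    (hcop : Nat.Coprime b.natDegree d.natDegree) (hd : 0 < d.natDegree) (q : ℕ → ℂ[X])
    (h : ∑ k ∈ Finset.range b.natDegree, (q k).comp b * d ^ k = 0) :
    ∀ k < b.natDegree, q k = 0 := by
  have hd0 : d ≠ 0 := ne_zero_of_natDegree_gt hd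
  have hcomp : ∀ k < b.natDegree, q k ≠ 0 → (q k).comp b ≠ 0 := by
    intro k hk hq h0
    rcases comp_eq_zero_iff.1 h0 with h1 | ⟨-, h1⟩
    · exact hq h1
    · rw [h1, natDegree_C] at hk
      omega
  by_contra! hne
  obtain ⟨k, hk, hqk⟩ := hne
  set s := (Finset.range b.natDegree).filter fun k => q k ≠ 0 with hs
  have hdeg : ∀ i ∈ s, ((q i).comp b * d ^ i).natDegree =
      (q i).natDegree * b.natDegree + i * d.natDegree := by
    intro i hi
    rw [hs, Finset.mem_filter, Finset.mem_range] at hi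
    rw [natDegree_mul (hcomp i hi.1 hi.2) (pow_ne_zero _ hd0), natDegree_comp, natDegree_pow]
  have hsum : ∑ k ∈ s, (q k).comp b * d ^ k = 0 := by
    rw [← h, hs, Finset.sum_filter]
    refine Finset.sum_congr rfl fun i _ => ?_
    by_cases hi : q i = 0 <;> simp [hi]
  obtain ⟨i, hi, hmax⟩ := s.exists_max_image (fun i => ((q i).comp b * d ^ i).natDegree)
    ⟨k, by rw [hs, Finset.mem_filter, Finset.mem_range]; exact ⟨hk, hqk⟩⟩
  have hne : (q i).comp b * d ^ i ≠ 0 := by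
    rw [hs, Finset.mem_filter, Finset.mem_range] at hi
    exact mul_ne_zero (hcomp i hi.1 hi.2) (pow_ne_zero _ hd0)
  have hlt : ∀ j ∈ s, j ≠ i →
      ((q j).comp b * d ^ j).natDegree < ((q i).comp b * d ^ i).natDegree := by
    intro j hj hji
    refine lt_of_le_of_ne (hmax j hj) fun he => hji ?_
    rw [hdeg j hj, hdeg i hi] at he
    have hmod : j * d.natDegree ≡ i * d.natDegree [MOD b.natDegree] := by
      have := congrArg (· % b.natDegree) he
      simpa [Nat.ModEq, Nat.add_mod] using this
    have h2 := Nat.ModEq.cancel_right_of_coprime hcop hmod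
    rw [hs, Finset.mem_filter, Finset.mem_range] at hi hj
    exact Nat.ModEq.eq_of_lt_of_lt h2 hj.1 hi.1
  have hc := congrArg (fun p : ℂ[X] => p.coeff ((q i).comp b * d ^ i).natDegree) hsum
  simp only [finsetSum_coeff, coeff_zero] at hc
  rw [Finset.sum_eq_single_of_mem i hi
    fun j hj hji => coeff_eq_zero_of_natDegree_lt (hlt j hj hji)] at hc
  exact hne (leadingCoeff_eq_zero.1 hc)

/-- If `a ∘ b = c ∘ d` with crosswise equal coprime degrees, then `d` maps the fibre of `b` over
`α` onto the fibre of `c` over `a(α)`, counting multiplicities. -/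
theorem map_roots_eq_roots {a b c d : ℂ[X]} (h : a.comp b = c.comp d)
    (hcb : c.natDegree = b.natDegree) (hcop : Nat.Coprime b.natDegree d.natDegree)
    (hb : 0 < b.natDegree) (hd : 0 < d.natDegree) (α : ℂ) :
    (b - C α).roots.map (fun z => d.eval z) = (c - C (a.eval α)).roots := by
  set n := b.natDegree with hn
  set m := d.natDegree with hm
  let F : ℂ[X][X][X] := b.map (C.comp C) - C (C X)
  let G : ℂ[X][X][X] := C X - d.map (C.comp C)
  let P : ℂ[X][X] := F.resultant G n m
  have hevC : ∀ x y : ℂ, (evalEvalRingHom x y).comp (C.comp C) = RingHom.id ℂ := by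
    intro x y
    ext z
    simp [evalEvalRingHom]
  have hP : ∀ x y : ℂ, P.evalEval x y =
      b.leadingCoeff ^ m * ((b - C x).roots.map fun z => y - d.eval z).prod := by
    intro x y
    have h1 : (F.map (evalEvalRingHom x y)).resultant (G.map (evalEvalRingHom x y)) n m =
        evalEvalRingHom x y P := resultant_map_map _ _ _ _ _
    have hF : F.map (evalEvalRingHom x y) = b - C x := by
      simp only [F, Polynomial.map_sub, map_map, hevC, map_C, map_id]
      simp [evalEvalRingHom]
    have hG : G.map (evalEvalRingHom x y) = C y - d := by
      simp only [G, Polynomial.map_sub, map_map, hevC, map_C, map_id]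
      simp [evalEvalRingHom]
    rw [hF, hG] at h1
    have hdegb : (b - C x).natDegree = n := natDegree_sub_C
    rw [resultant_eq_prod_eval_of_natDegree_eq hdegb (natDegree_sub_le_of_le
      (natDegree_C y).le le_rfl |>.trans (by simp [hm])), leadingCoeff_sub_C hb] at h1
    rw [← coe_evalEvalRingHom, ← h1]
    simp only [eval_sub, eval_C]
  have hmap : ∀ x : ℂ, P.map (evalRingHom x) = C (b.leadingCoeff ^ m) *
      (((b - C x).roots.map fun z => d.eval z).map fun t => X - C t).prod := by
    intro x
    refine Polynomial.funext fun y => ?_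
    rw [eval_mul, eval_C, eval_multiset_prod, Multiset.map_map, Multiset.map_map,
      map_evalRingHom_eval, hP]
    simp
  have hcard : ∀ x : ℂ, Multiset.card ((b - C x).roots.map fun z => d.eval z) = n := by
    intro x
    rw [Multiset.card_map, IsAlgClosed.card_roots_eq_natDegree, natDegree_sub_C]
  have hlc : b.leadingCoeff ≠ 0 := leadingCoeff_ne_zero.2 (ne_zero_of_natDegree_gt hb)
  have hcn : 0 < c.natDegree := hcb ▸ hb
  have hlc' : c.leadingCoeff ≠ 0 := leadingCoeff_ne_zero.2 (ne_zero_of_natDegree_gt hcn)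
  set κ : ℂ := b.leadingCoeff ^ m / c.leadingCoeff with hκ
  have hκ0 : κ ≠ 0 := div_ne_zero (pow_ne_zero _ hlc) hlc'
  let Q : ℂ[X][X] := P - C (C κ) * (c.map C - C a)
  have hQmap : ∀ x : ℂ, Q.map (evalRingHom x) =
      P.map (evalRingHom x) - C κ * (c - C (a.eval x)) := by
    intro x
    have : (evalRingHom x).comp C = RingHom.id ℂ := by ext; simp
    simp [Q, Polynomial.map_sub, map_map, this]
  have hQcoeff : ∀ k, n ≤ k → Q.coeff k = 0 := by
    intro k hk
    refine Polynomial.funext fun x => ?_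
    have h1 : (Q.coeff k).eval x = (Q.map (evalRingHom x)).coeff k := by
      rw [coeff_map, coe_evalRingHom]
    rw [h1, hQmap, hmap, coeff_sub, coeff_C_mul, coeff_C_mul, eval_zero]
    have hnd := natDegree_multiset_prod_X_sub_C_eq_card ((b - C x).roots.map fun z => d.eval z)
    have hmon := monic_multiset_prod_of_monic ((b - C x).roots.map fun z => d.eval z)
      (fun t => X - C t) fun t _ => monic_X_sub_C t
    rw [hcard] at hnd
    rcases hk.eq_or_lt with rfl | hk
    · rw [Monic, leadingCoeff, hnd] at hmon
      have : (c - C (a.eval x)).coeff n = c.leadingCoeff := by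
        rw [coeff_sub, coeff_C, if_neg hb.ne', sub_zero, leadingCoeff, hcb]
      rw [hmon, this, hκ]
      field_simp
      ring
    · rw [coeff_eq_zero_of_natDegree_lt (hnd ▸ hk), coeff_eq_zero_of_natDegree_lt]
      · ring
      · rw [natDegree_sub_C, hcb]; exact hk
  have hQ : Q = 0 := by
    have hdeg : Q.natDegree < n := by
      refine lt_of_not_ge fun hge => ?_
      have h0 : Q = 0 := leadingCoeff_eq_zero.1 (hQcoeff _ hge)
      rw [h0, natDegree_zero] at hge
      omega
    have hsum : ∑ k ∈ Finset.range n, (Q.coeff k).comp b * d ^ k = 0 := by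
      refine Polynomial.funext fun z => ?_
      have h1 : (Q.map (evalRingHom (b.eval z))).eval (d.eval z) = 0 := by
        rw [hQmap, eval_sub, map_evalRingHom_eval, hP]
        have hz : z ∈ (b - C (b.eval z)).roots := by
          rw [mem_roots (ne_zero_of_natDegree_gt (n := 0) (by rwa [natDegree_sub_C]))]
          simp
        rw [Multiset.prod_eq_zero (Multiset.mem_map.2 ⟨z, hz, sub_self (d.eval z)⟩)]
        have := congrArg (eval z) h
        rw [eval_comp, eval_comp] at this
        simp [this]
      rw [eval_eq_sum_range' (lt_of_le_of_lt natDegree_map_le hdeg)] at h1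
      rw [eval_finsetSum, eval_zero, ← h1]
      refine Finset.sum_congr rfl fun k _ => ?_
      simp [eval_comp]
    ext1 k
    rw [coeff_zero]
    rcases lt_or_ge k n with hk | hk
    · exact eq_zero_of_sum_comp_mul_pow_eq_zero hcop hd _ hsum k hk
    · exact hQcoeff k hk
  have hfin := hQmap α
  rw [hQ, Polynomial.map_zero, hmap, eq_comm, sub_eq_zero] at hfin
  have := congrArg roots hfin
  rwa [roots_C_mul _ (pow_ne_zero _ hlc), roots_C_mul _ hκ0, roots_multiset_prod_X_sub_C] at this

/-- The ramification index of `g` at `z`. -/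
def ramIndex (g : ℂ[X]) (z : ℂ) : ℕ :=
  (g - C (g.eval z)).rootMultiplicity z

/-- The set of preimages of `v` under `g`. -/
def fiber (g : ℂ[X]) (v : ℂ) : Finset ℂ :=
  (g - C v).roots.toFinset

/-- The critical values of `g`, counted with multiplicity. -/
def criticalValues (g : ℂ[X]) : Multiset ℂ :=
  g.derivative.roots.map fun z => g.eval z

theorem sub_C_ne_zero {g : ℂ[X]} (hg : 0 < g.natDegree) (v : ℂ) : g - C v ≠ 0 :=
  ne_zero_of_natDegree_gt (n := 0) (by rwa [natDegree_sub_C])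

theorem mem_fiber {g : ℂ[X]} (hg : 0 < g.natDegree) {v z : ℂ} :
    z ∈ fiber g v ↔ g.eval z = v := by
  rw [fiber, Multiset.mem_toFinset, mem_roots (sub_C_ne_zero hg v), IsRoot.def, eval_sub, eval_C,
    sub_eq_zero]

theorem count_roots_eq_ramIndex {g : ℂ[X]} {v z : ℂ} (h : g.eval z = v) :
    (g - C v).roots.count z = ramIndex g z := by
  rw [count_roots, ramIndex, h]

theorem ramIndex_pos {g : ℂ[X]} (hg : 0 < g.natDegree) (z : ℂ) : 0 < ramIndex g z := by
  rw [ramIndex, rootMultiplicity_pos (sub_C_ne_zero hg _)]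
  simp

theorem sum_ramIndex {g : ℂ[X]} (hg : 0 < g.natDegree) (v : ℂ) :
    ∑ z ∈ fiber g v, ramIndex g z = g.natDegree := by
  have h := Multiset.toFinset_sum_count_eq (g - C v).roots
  rw [IsAlgClosed.card_roots_eq_natDegree, natDegree_sub_C] at h
  rw [← h]
  exact Finset.sum_congr rfl fun z hz => (count_roots_eq_ramIndex ((mem_fiber hg).1 hz)).symm

theorem fiber_nonempty {g : ℂ[X]} (hg : 0 < g.natDegree) (v : ℂ) : (fiber g v).Nonempty := by
  rw [Finset.nonempty_iff_ne_empty]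
  intro h
  have := sum_ramIndex hg v
  rw [h, Finset.sum_empty] at this
  omega

theorem ramIndex_comp {p q : ℂ[X]} (hp : 0 < p.natDegree) (hq : 0 < q.natDegree) (z : ℂ) :
    ramIndex (p.comp q) z = ramIndex p (q.eval z) * ramIndex q z := by
  obtain ⟨u, hu, hu0⟩ := exists_eq_pow_rootMultiplicity_mul_and_not_dvd
    (p - C (p.eval (q.eval z))) (sub_C_ne_zero hp _) (q.eval z)
  have h1 : p.comp q - C ((p.comp q).eval z) =
      (q - C (q.eval z)) ^ ramIndex p (q.eval z) * u.comp q := by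
    have := congrArg (fun r : ℂ[X] => r.comp q) hu
    simpa [eval_comp, ramIndex] using this
  have hne : p.comp q - C ((p.comp q).eval z) ≠ 0 :=
    sub_C_ne_zero (by rw [natDegree_comp]; positivity) _
  have h2 : (u.comp q).rootMultiplicity z = 0 := by
    rw [rootMultiplicity_eq_zero_iff]
    intro h
    rw [IsRoot.def, eval_comp] at h
    exact absurd (dvd_iff_isRoot.2 h) hu0
  have h3 : (p.comp q - C ((p.comp q).eval z)).rootMultiplicity z = ramIndex (p.comp q) z := rfl
  rw [h1] at hne h3
  rw [← h3, rootMultiplicity_mul hne, h2, add_zero, ← count_roots, roots_pow,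
    Multiset.count_nsmul, count_roots, ramIndex, ramIndex]

theorem card_criticalValues (g : ℂ[X]) :
    Multiset.card (criticalValues g) = g.natDegree - 1 := by
  rw [criticalValues, Multiset.card_map, IsAlgClosed.card_roots_eq_natDegree, natDegree_derivative]

theorem rootMultiplicity_derivative {g : ℂ[X]} (hg : 0 < g.natDegree) (z : ℂ) :
    g.derivative.rootMultiplicity z + 1 = ramIndex g z := by
  have h : (g - C (g.eval z)).IsRoot z := by simp
  have h1 := derivative_rootMultiplicity_of_root h
  rw [derivative_sub, derivative_C, sub_zero] at h1
  have := ramIndex_pos hg z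
  rw [ramIndex] at this ⊢
  omega

theorem count_map_eq_sum_count (s : Multiset ℂ) (φ : ℂ → ℂ) (v : ℂ) (t : Finset ℂ)
    (ht : ∀ z ∈ t, φ z = v) (hs : ∀ z ∈ s, φ z = v → z ∈ t) :
    (s.map φ).count v = ∑ z ∈ t, s.count z := by
  rw [Multiset.count_map, ← Multiset.sum_count_eq_card (s := t)]
  · exact Finset.sum_congr rfl fun z hz =>
      Multiset.count_filter_of_pos (p := fun z => v = φ z) (ht z hz).symm
  · intro z hz
    rw [Multiset.mem_filter] at hz
    exact hs z hz.1 hz.2.symm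

theorem count_criticalValues {g : ℂ[X]} (hg : 0 < g.natDegree) (v : ℂ) :
    (criticalValues g).count v + (fiber g v).card = g.natDegree := by
  have h : (criticalValues g).count v = ∑ z ∈ fiber g v, g.derivative.rootMultiplicity z := by
    rw [criticalValues, count_map_eq_sum_count _ _ _ (fiber g v)
      (fun z hz => (mem_fiber hg).1 hz) fun z _ hz => (mem_fiber hg).2 hz]
    simp only [count_roots]
  rw [h, Finset.card_eq_sum_ones, ← Finset.sum_add_distrib, ← sum_ramIndex hg v]
  exact Finset.sum_congr rfl fun z _ => rootMultiplicity_derivative hg z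

/-- The critical values of `b`, pushed forward by `a`. -/
theorem count_map_criticalValues {a b : ℂ[X]} (ha : 0 < a.natDegree) (v : ℂ) :
    ((criticalValues b).map fun x => a.eval x).count v =
      ∑ x ∈ fiber a v, (criticalValues b).count x :=
  count_map_eq_sum_count _ _ _ _ (fun _ hz => (mem_fiber ha).1 hz) fun _ _ hz => (mem_fiber ha).2 hz

/-- The hypotheses of Ritt's second theorem, without indecomposability. -/
structure CoprimeCross (a b c d : ℂ[X]) : Prop where
  comp_eq : a.comp b = c.comp d
  natDegree_d : d.natDegree = a.natDegree
  natDegree_c : c.natDegree = b.natDegree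
  coprime : Nat.Coprime a.natDegree b.natDegree
  pos_a : 0 < a.natDegree
  pos_b : 0 < b.natDegree

namespace CoprimeCross

variable {a b c d : ℂ[X]}

theorem symm (h : CoprimeCross a b c d) : CoprimeCross c d a b where
  comp_eq := h.comp_eq.symm
  natDegree_d := h.natDegree_c.symm
  natDegree_c := h.natDegree_d.symm
  coprime := by rw [h.natDegree_c, h.natDegree_d]; exact h.coprime.symm
  pos_a := h.natDegree_c ▸ h.pos_b
  pos_b := h.natDegree_d ▸ h.pos_a

theorem pos_c (h : CoprimeCross a b c d) : 0 < c.natDegree := h.symm.pos_a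

theorem pos_d (h : CoprimeCross a b c d) : 0 < d.natDegree := h.symm.pos_b

theorem eval_eq (h : CoprimeCross a b c d) (z : ℂ) :
    a.eval (b.eval z) = c.eval (d.eval z) := by
  rw [← eval_comp, h.comp_eq, eval_comp]

theorem ramIndex_mul (h : CoprimeCross a b c d) (z : ℂ) :
    ramIndex a (b.eval z) * ramIndex b z = ramIndex c (d.eval z) * ramIndex d z := by
  rw [← ramIndex_comp h.pos_a h.pos_b, h.comp_eq, ramIndex_comp h.pos_c h.pos_d]

theorem sum_ramIndex_eq (h : CoprimeCross a b c d) {x y : ℂ} (hxy : a.eval x = c.eval y) :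
    ∑ z ∈ (fiber b x).filter (fun z => d.eval z = y), ramIndex b z = ramIndex c y := by
  have h1 := congrArg (Multiset.count y) (map_roots_eq_roots h.comp_eq h.natDegree_c
    (by rw [h.natDegree_d]; exact h.coprime.symm) h.pos_b h.pos_d x)
  rw [count_roots_eq_ramIndex hxy.symm, count_map_eq_sum_count _ _ _
    ((fiber b x).filter (fun z => d.eval z = y)) (fun z hz => (Finset.mem_filter.1 hz).2)
    fun z hz hzy => Finset.mem_filter.2 ⟨Multiset.mem_toFinset.2 hz, hzy⟩] at h1
  rw [← h1]
  exact Finset.sum_congr rfl fun z hz =>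
    (count_roots_eq_ramIndex ((mem_fiber h.pos_b).1 (Finset.mem_filter.1 hz).1)).symm

theorem card_filter_le_gcd (h : CoprimeCross a b c d) {x y : ℂ} (hxy : a.eval x = c.eval y) :
    ((fiber b x).filter fun z => d.eval z = y).card ≤ Nat.gcd (ramIndex a x) (ramIndex c y) := by
  set e := ramIndex a x with he
  set f := ramIndex c y with hf
  have he0 : 0 < e := ramIndex_pos h.pos_a x
  have hg : 0 < Nat.gcd e f := Nat.gcd_pos_of_pos_left _ he0
  have hle : ∀ z ∈ (fiber b x).filter (fun z => d.eval z = y), f / Nat.gcd e f ≤ ramIndex b z := by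
    intro z hz
    rw [Finset.mem_filter, mem_fiber h.pos_b] at hz
    have h1 := h.ramIndex_mul z
    rw [hz.1, hz.2, ← he, ← hf] at h1
    refine Nat.le_of_dvd (ramIndex_pos h.pos_b z) ?_
    have h2 : f ∣ e * ramIndex b z := ⟨_, h1⟩
    obtain ⟨e', he'⟩ := Nat.gcd_dvd_left e f
    have hco := Nat.coprime_div_gcd_div_gcd (m := e) (n := f) hg
    refine hco.symm.dvd_of_dvd_mul_left ?_
    rw [← Nat.mul_div_right_comm (Nat.gcd_dvd_left e f)]
    exact Nat.div_dvd_div (Nat.gcd_dvd_right e f) h2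
  have hsum := Finset.card_nsmul_le_sum _ _ _ hle
  rw [h.sum_ramIndex_eq hxy, smul_eq_mul, ← hf] at hsum
  have h3 : f / Nat.gcd e f * Nat.gcd e f = f := Nat.div_mul_cancel (Nat.gcd_dvd_right e f)
  have hf0 : 0 < f := ramIndex_pos h.pos_c y
  have h4 : 0 < f / Nat.gcd e f := Nat.div_pos (Nat.gcd_le_right _ hf0) hg
  refine Nat.le_of_mul_le_mul_right (c := f / Nat.gcd e f) ?_ h4
  rw [mul_comm (Nat.gcd e f), h3]
  exact hsum

theorem card_fiber_le_sum (h : CoprimeCross a b c d) (x : ℂ) :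
    (fiber b x).card ≤
      ∑ y ∈ fiber c (a.eval x), Nat.gcd (ramIndex a x) (ramIndex c y) := by
  rw [Finset.card_eq_sum_card_fiberwise (f := fun z => d.eval z) (t := fiber c (a.eval x))]
  · exact Finset.sum_le_sum fun y hy => h.card_filter_le_gcd ((mem_fiber h.pos_c).1 hy).symm
  · intro z hz
    rw [Finset.mem_coe, mem_fiber h.pos_b] at hz
    rw [Finset.mem_coe, mem_fiber h.pos_c, ← h.eval_eq, hz]

theorem count_criticalValues_le (h : CoprimeCross a b c d) {x : ℂ} (hx : ramIndex a x = 1) :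
    (criticalValues c).count (a.eval x) ≤ (criticalValues b).count x := by
  have h1 := h.card_fiber_le_sum x
  simp only [hx, Nat.gcd_one_left, Finset.sum_const, smul_eq_mul, mul_one] at h1
  have h2 := count_criticalValues h.pos_b x
  have h3 := count_criticalValues h.pos_c (a.eval x)
  rw [h.natDegree_c] at h3
  omega

end CoprimeCross

theorem sub_C_eq_prod {g : ℂ[X]} (hg : 0 < g.natDegree) (v : ℂ) :
    g - C v = C g.leadingCoeff * ∏ z ∈ fiber g v, (X - C z) ^ ramIndex g z := by
  have h := (IsAlgClosed.splits (g - C v)).eq_prod_roots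
  rw [leadingCoeff_sub_C hg, Finset.prod_multiset_map_count] at h
  refine h.trans (congrArg _ (Finset.prod_congr rfl fun z hz => ?_))
  rw [count_roots_eq_ramIndex ((mem_fiber hg).1 hz)]

/-- An indecomposable polynomial with a fibre all of whose ramification indices share a factor is
totally ramified there. -/
theorem Indecomposable.card_fiber_eq_one {g : ℂ[X]} (hg : Indecomposable g) {v : ℂ} {k : ℕ}
    (hk : 2 ≤ k) (h : ∀ z ∈ fiber g v, k ∣ ramIndex g z) : (fiber g v).card = 1 := by
  have h0 : 0 < g.natDegree := by have := hg.1; omega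
  set W : ℂ[X] := ∏ z ∈ fiber g v, (X - C z) ^ (ramIndex g z / k) with hW
  have hgW : g = (C g.leadingCoeff * X ^ k + C v).comp W := by
    have h1 : W ^ k = ∏ z ∈ fiber g v, (X - C z) ^ ramIndex g z := by
      rw [hW, ← Finset.prod_pow]
      exact Finset.prod_congr rfl fun z hz => by rw [← pow_mul, Nat.div_mul_cancel (h z hz)]
    simp only [add_comp, mul_comp, C_comp, pow_comp, X_comp]
    rw [h1, ← sub_C_eq_prod h0, sub_add_cancel]
  have hdk : (C g.leadingCoeff * X ^ k + C v).natDegree = k := by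
    rw [natDegree_add_C, natDegree_C_mul_X_pow k _ (leadingCoeff_ne_zero.2
      (ne_zero_of_natDegree_gt h0))]
  have hdW : W.natDegree = ∑ z ∈ fiber g v, ramIndex g z / k := by
    rw [hW, natDegree_prod_of_monic _ _ fun z _ => (monic_X_sub_C z).pow _]
    exact Finset.sum_congr rfl fun z _ => by rw [natDegree_pow, natDegree_X_sub_C, mul_one]
  have hle : (fiber g v).card ≤ W.natDegree := by
    rw [hdW, Finset.card_eq_sum_ones]
    exact Finset.sum_le_sum fun z hz =>
      Nat.div_pos (Nat.le_of_dvd (ramIndex_pos h0 z) (h z hz)) (by omega)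
  have hlt : W.natDegree < 2 := by
    by_contra! hge
    exact hg.2 ⟨_, W, hk.trans hdk.ge, hge, hgW⟩
  have := (fiber_nonempty h0 v).card_pos
  omega

theorem sum_gcd_le {ι : Type*} (t : Finset ι) (e : ι → ℕ) {f : ℕ} (hf : 0 < f)
    (ht : t.Nonempty) (h : ∀ k, (∀ i ∈ t, k ∣ e i) → k ≤ 1) :
    ∑ i ∈ t, Nat.gcd (e i) f ≤ (t.card - 1) * f + 1 := by
  classical
  have hle : ∀ i, Nat.gcd (e i) f ≤ f := fun i => Nat.gcd_le_right _ hf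
  by_cases hone : ∃ i ∈ t, ∀ j ∈ t, j ≠ i → f ∣ e j
  · obtain ⟨i, hi, hj⟩ := hone
    have h1 : Nat.gcd (e i) f ≤ 1 := by
      refine h _ fun j hjt => ?_
      rcases eq_or_ne j i with rfl | hji
      · exact Nat.gcd_dvd_left _ _
      · exact (Nat.gcd_dvd_right _ _).trans (hj j hjt hji)
    rw [← Finset.add_sum_erase t _ hi]
    have h2 := Finset.sum_le_card_nsmul (t.erase i) (fun j => Nat.gcd (e j) f) f fun j _ => hle j
    rw [Finset.card_erase_of_mem hi, smul_eq_mul] at h2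
    omega
  · push Not at hone
    obtain ⟨i₀, hi₀⟩ := ht
    obtain ⟨i, hi, -, hfi⟩ := hone i₀ hi₀
    obtain ⟨j, hj, hji, hfj⟩ := hone i hi
    have hhalf : ∀ k, ¬ f ∣ e k → 2 * Nat.gcd (e k) f ≤ f := by
      intro k hk
      obtain ⟨w, hw⟩ := Nat.gcd_dvd_right (e k) f
      have hw1 : w ≠ 1 := by
        rintro rfl
        rw [mul_one] at hw
        exact hk (hw ▸ Nat.gcd_dvd_left _ _)
      have hw0 : w ≠ 0 := by
        rintro rfl
        omega
      calc 2 * Nat.gcd (e k) f ≤ w * Nat.gcd (e k) f := Nat.mul_le_mul_right _ (by omega)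
        _ = f := by rw [mul_comm]; exact hw.symm
    have hj' : j ∈ t.erase i := Finset.mem_erase.2 ⟨hji, hj⟩
    rw [← Finset.add_sum_erase t _ hi, ← Finset.add_sum_erase _ _ hj']
    have h2 := Finset.sum_le_card_nsmul ((t.erase i).erase j) (fun j => Nat.gcd (e j) f) f
      fun j _ => hle j
    have hcard : ((t.erase i).erase j).card + 1 = (t.erase i).card :=
      Finset.card_erase_add_one hj'
    rw [← Finset.card_erase_of_mem hi, ← hcard, add_mul, one_mul]
    rw [smul_eq_mul] at h2
    have := hhalf i hfi
    have := hhalf j hfj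
    omega

theorem sum_count_le_card (s : Multiset ℂ) (T : Finset ℂ) : ∑ v ∈ T, s.count v ≤ s.card := by
  rw [← Multiset.toFinset_sum_count_eq s]
  refine Finset.sum_le_sum_of_ne_zero fun v _ hv => ?_
  rw [Multiset.mem_toFinset]
  exact Multiset.count_ne_zero.1 hv

/-- The unramified points of the fibre of `g` over `v`. -/
def simpleFiber (g : ℂ[X]) (v : ℂ) : Finset ℂ :=
  (fiber g v).filter fun z => ramIndex g z = 1

theorem two_mul_card_fiber_le {g : ℂ[X]} (hg : 0 < g.natDegree) (v : ℂ) :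
    2 * (fiber g v).card ≤ g.natDegree + (simpleFiber g v).card ∧
    (2 * (fiber g v).card = g.natDegree + (simpleFiber g v).card ↔
      ∀ z ∈ fiber g v, ramIndex g z ≤ 2) := by
  have h1 : ∀ z ∈ fiber g v, 2 ≤ ramIndex g z + if ramIndex g z = 1 then 1 else 0 := by
    intro z _
    have := ramIndex_pos hg z
    split_ifs <;> omega
  have h2 : ∑ z ∈ fiber g v, (ramIndex g z + if ramIndex g z = 1 then 1 else 0) =
      g.natDegree + (simpleFiber g v).card := by
    rw [Finset.sum_add_distrib, sum_ramIndex hg, simpleFiber, Finset.card_filter]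
  have h3 : ∑ z ∈ fiber g v, 2 = 2 * (fiber g v).card := by
    rw [Finset.sum_const, smul_eq_mul, mul_comm]
  rw [← h2, ← h3]
  refine ⟨Finset.sum_le_sum h1, ?_⟩
  rw [Finset.sum_eq_sum_iff_of_le h1]
  refine forall₂_congr fun z _ => ?_
  have := ramIndex_pos hg z
  split_ifs <;> omega

/-- Over `v`, the polynomial `g` has one simple preimage, and all others are double. -/
def IsFolded (g : ℂ[X]) (v : ℂ) : Prop :=
  (simpleFiber g v).card = 1 ∧ ∀ z ∈ fiber g v, ramIndex g z ≤ 2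

namespace CoprimeCross

variable {a b c d : ℂ[X]}

theorem card_simpleFiber_mul_le (h : CoprimeCross a b c d) (v : ℂ) :
    (simpleFiber a v).card * (criticalValues c).count v ≤
      ((criticalValues b).map fun x => a.eval x).count v := by
  rw [count_map_criticalValues h.pos_a, ← smul_eq_mul]
  refine (Finset.card_nsmul_le_sum (simpleFiber a v) _ _ fun x hx => ?_).trans
    (Finset.sum_le_sum_of_subset (Finset.filter_subset _ _))
  rw [simpleFiber, Finset.mem_filter, mem_fiber h.pos_a] at hx
  rw [← hx.1]
  exact h.count_criticalValues_le hx.2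

theorem card_fiber_eq_one_of_heavy (h : CoprimeCross a b c d) (ha : Indecomposable a) {v : ℂ}
    (hv : 2 * (fiber a v).card ≤ a.natDegree) :
    (fiber a v).card = 1 ∨ (fiber c v).card = 1 := by
  by_contra! hne
  have hgcd : ∀ k, (∀ x ∈ fiber a v, k ∣ ramIndex a x) → k ≤ 1 := by
    intro k hk
    by_contra! hk2
    exact hne.1 (ha.card_fiber_eq_one hk2 hk)
  have hcount : ∀ w, w ≠ v → 2 * (criticalValues c).count w ≤
      ((criticalValues b).map fun x => a.eval x).count w := by
    intro w hw
    refine le_trans (Nat.mul_le_mul_right _ ?_) (h.card_simpleFiber_mul_le w)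
    have h1 := sum_count_le_card (criticalValues a) {w, v}
    rw [Finset.sum_pair hw, card_criticalValues] at h1
    have h2 := count_criticalValues h.pos_a w
    have h3 := count_criticalValues h.pos_a v
    have h4 := (two_mul_card_fiber_le h.pos_a w).1
    have := h.pos_a
    omega
  have hle : 2 • criticalValues c +
      Multiset.replicate (((criticalValues b).map fun x => a.eval x).count v) v ≤
      ((criticalValues b).map fun x => a.eval x) +
        Multiset.replicate (2 * (criticalValues c).count v) v := by
    rw [Multiset.le_iff_count]
    intro w
    rw [Multiset.count_add, Multiset.count_add, Multiset.count_nsmul, Multiset.count_replicate,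
      Multiset.count_replicate]
    rcases eq_or_ne v w with rfl | hw
    · simp only [if_true]
      omega
    · simp only [if_neg hw, add_zero]
      exact hcount w hw.symm
  have hcard := Multiset.card_le_card hle
  simp only [Multiset.card_add, Multiset.card_nsmul, Multiset.card_replicate, Multiset.card_map,
    card_criticalValues, count_map_criticalValues h.pos_a] at hcard
  have hK := count_criticalValues h.pos_c v
  have hA : ∑ x ∈ fiber a v, (criticalValues b).count x + ∑ x ∈ fiber a v, (fiber b x).card =
      (fiber a v).card * b.natDegree := by
    rw [← Finset.sum_add_distrib, Finset.sum_congr rfl fun x _ => count_criticalValues h.pos_b x,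
      Finset.sum_const, smul_eq_mul]
  have hN : ∑ x ∈ fiber a v, (fiber b x).card ≤
      ((fiber a v).card - 1) * b.natDegree + (fiber c v).card := by
    calc ∑ x ∈ fiber a v, (fiber b x).card
        ≤ ∑ x ∈ fiber a v, ∑ y ∈ fiber c v, Nat.gcd (ramIndex a x) (ramIndex c y) := by
          refine Finset.sum_le_sum fun x hx => ?_
          have := h.card_fiber_le_sum x
          rwa [(mem_fiber h.pos_a).1 hx] at this
      _ = ∑ y ∈ fiber c v, ∑ x ∈ fiber a v, Nat.gcd (ramIndex a x) (ramIndex c y) :=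
          Finset.sum_comm
      _ ≤ ∑ y ∈ fiber c v, (((fiber a v).card - 1) * ramIndex c y + 1) :=
          Finset.sum_le_sum fun y _ => sum_gcd_le _ _ (ramIndex_pos h.pos_c y)
            (fiber_nonempty h.pos_a v) hgcd
      _ = _ := by
          rw [Finset.sum_add_distrib, ← Finset.mul_sum, sum_ramIndex h.pos_c, h.natDegree_c,
            Finset.sum_const, smul_eq_mul, mul_one]
  have ha1 := (fiber_nonempty h.pos_a v).card_pos
  have hc1 := (fiber_nonempty h.pos_c v).card_pos
  obtain ⟨r, hr⟩ : ∃ r, (fiber a v).card = r + 1 := ⟨_, (Nat.succ_pred_eq_of_pos ha1).symm⟩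
  rw [hr, Nat.add_sub_cancel] at hN
  rw [hr, add_mul, one_mul] at hA
  have := h.natDegree_c
  have := h.pos_b
  omega

theorem exists_fiber (h : CoprimeCross a b c d) (ha : Indecomposable a) (hc : Indecomposable c) :
    (∃ v, (fiber a v).card = 1) ∨ (∃ v, (fiber c v).card = 1) ∨
    ∃ v w, v ≠ w ∧ IsFolded a v ∧ IsFolded a w ∧ IsFolded c v ∧ IsFolded c w := by
  by_cases hheavy : ∃ v, 2 * (fiber a v).card ≤ a.natDegree
  · obtain ⟨v, hv⟩ := hheavy
    rcases h.card_fiber_eq_one_of_heavy ha hv with h1 | h1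
    · exact Or.inl ⟨v, h1⟩
    · exact Or.inr (Or.inl ⟨v, h1⟩)
  push Not at hheavy
  by_cases htot : ∃ v, (fiber c v).card = 1
  · exact Or.inr (Or.inl htot)
  push Not at htot
  have hsimple : ∀ v, 1 ≤ (simpleFiber a v).card := by
    intro v
    have h1 := (two_mul_card_fiber_le h.pos_a v).1
    have h2 := hheavy v
    omega
  have heq : criticalValues c = (criticalValues b).map fun x => a.eval x := by
    refine Multiset.eq_of_le_of_card_le (Multiset.le_iff_count.2 fun v => ?_) ?_
    · exact le_trans (Nat.le_mul_of_pos_left _ (hsimple v)) (h.card_simpleFiber_mul_le v)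
    · rw [Multiset.card_map, card_criticalValues, card_criticalValues, h.natDegree_c]
  have ha2 := ha.1
  have hc2 := hc.1
  have hbranch : ∀ v ∈ criticalValues c, IsFolded a v ∧ ∀ y ∈ fiber c v, ramIndex c y ≤ 2 := by
    intro v hv
    have hpos := Multiset.count_pos.2 hv
    have h1 := h.card_simpleFiber_mul_le v
    rw [← heq] at h1
    have hone : (simpleFiber a v).card = 1 :=
      le_antisymm (Nat.le_of_mul_le_mul_right (by rwa [one_mul]) hpos) (hsimple v)
    have h2 := two_mul_card_fiber_le h.pos_a v
    have h3 := hheavy v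
    have hfold : ∀ z ∈ fiber a v, ramIndex a z ≤ 2 := h2.2.1 (by omega)
    refine ⟨⟨hone, hfold⟩, ?_⟩
    obtain ⟨x₁, hx₁⟩ := Finset.card_eq_one.1 hone
    have hmem₁ : x₁ ∈ simpleFiber a v := hx₁ ▸ Finset.mem_singleton_self x₁
    rw [simpleFiber, Finset.mem_filter, mem_fiber h.pos_a] at hmem₁
    obtain ⟨x₂, hx₂, hne⟩ := Finset.exists_mem_ne (s := fiber a v) (by omega) x₁
    have hram₂ : ramIndex a x₂ = 2 := by
      have h4 := ramIndex_pos h.pos_a x₂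
      have h5 := hfold x₂ hx₂
      have h6 : ramIndex a x₂ ≠ 1 := by
        intro h7
        have : x₂ ∈ simpleFiber a v := Finset.mem_filter.2 ⟨hx₂, h7⟩
        rw [hx₁, Finset.mem_singleton] at this
        exact hne this
      omega
    have hzero : (criticalValues b).count x₂ = 0 := by
      have h4 := count_map_criticalValues (b := b) h.pos_a v
      rw [← heq] at h4
      have h5 := h.count_criticalValues_le hmem₁.2
      rw [hmem₁.1] at h5
      have h6 := Finset.sum_le_sum_of_subset (f := fun x => (criticalValues b).count x)
        (s := {x₁, x₂}) (t := fiber a v) (by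
          intro x hx
          rw [Finset.mem_insert, Finset.mem_singleton] at hx
          rcases hx with rfl | rfl
          · exact (mem_fiber h.pos_a).2 hmem₁.1
          · exact hx₂)
      rw [Finset.sum_pair hne.symm] at h6
      omega
    have hcard := count_criticalValues h.pos_b x₂
    rw [hzero, zero_add] at hcard
    have hle := h.card_fiber_le_sum x₂
    rw [(mem_fiber h.pos_a).1 hx₂, hcard, hram₂, ← h.natDegree_c, ← sum_ramIndex h.pos_c v] at hle
    have hterm : ∀ y ∈ fiber c v, Nat.gcd 2 (ramIndex c y) ≤ ramIndex c y := fun y _ =>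
      Nat.gcd_le_right _ (ramIndex_pos h.pos_c y)
    have hall := (Finset.sum_eq_sum_iff_of_le hterm).1 (le_antisymm (Finset.sum_le_sum hterm) hle)
    intro y hy
    rw [← hall y hy]
    exact Nat.gcd_le_left _ two_pos
  have hfoldc : ∀ v ∈ criticalValues c,
      2 * (fiber c v).card = c.natDegree + (simpleFiber c v).card ∧ (simpleFiber c v).card ≠ 0 := by
    intro v hv
    refine ⟨(two_mul_card_fiber_le h.pos_c v).2.2 (hbranch v hv).2, fun h0 => htot v ?_⟩
    refine hc.card_fiber_eq_one le_rfl fun z hz => ?_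
    have h1 : ramIndex c z ≠ 1 := fun h1 => by
      rw [Finset.card_eq_zero] at h0
      exact Finset.notMem_empty z (h0 ▸ Finset.mem_filter.2 ⟨hz, h1⟩)
    have h2 := (hbranch v hv).2 z hz
    have h3 := ramIndex_pos h.pos_c z
    rw [show ramIndex c z = 2 by omega]
  have hT : (criticalValues c).toFinset.card ≤ 2 := by
    have h1 := sum_count_le_card (criticalValues a) (criticalValues c).toFinset
    rw [card_criticalValues] at h1
    by_contra! h3
    have h2 := Finset.card_nsmul_le_sum (criticalValues c).toFinset
      (fun v => (criticalValues a).count v) ((a.natDegree - 1) / 2) (by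
        intro v hv
        have h4 := (hbranch v (Multiset.mem_toFinset.1 hv)).1
        have h5 := (two_mul_card_fiber_le h.pos_a v).2.2 h4.2
        have h6 := count_criticalValues h.pos_a v
        rw [h4.1] at h5
        omega)
    have hv : ∃ v, v ∈ criticalValues c := by
      obtain ⟨v, hv⟩ := Finset.card_pos.1 (show 0 < (criticalValues c).toFinset.card by omega)
      exact ⟨v, Multiset.mem_toFinset.1 hv⟩
    obtain ⟨v, hv⟩ := hv
    have h4 := (hbranch v hv).1
    have h5 := (two_mul_card_fiber_le h.pos_a v).2.2 h4.2
    rw [h4.1] at h5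
    rw [smul_eq_mul] at h2
    have h6 := Nat.mul_le_mul_right ((a.natDegree - 1) / 2) h3
    omega
  have hsum := Multiset.toFinset_sum_count_eq (criticalValues c)
  rw [card_criticalValues] at hsum
  have hT2 : (criticalValues c).toFinset.card = 2 := by
    by_contra hne
    have hlt : (criticalValues c).toFinset.card = 0 ∨ (criticalValues c).toFinset.card = 1 := by
      omega
    rcases hlt with h0 | h1
    · rw [Finset.card_eq_zero] at h0
      rw [h0, Finset.sum_empty] at hsum
      omega
    · obtain ⟨v, hv⟩ := Finset.card_eq_one.1 h1
      rw [hv, Finset.sum_singleton] at hsum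
      have := count_criticalValues h.pos_c v
      exact htot v (by omega)
  obtain ⟨v, w, hvw, hT⟩ := Finset.card_eq_two.1 hT2
  have hv : v ∈ criticalValues c := by
    rw [← Multiset.mem_toFinset, hT]
    exact Finset.mem_insert_self v _
  have hw : w ∈ criticalValues c := by
    rw [← Multiset.mem_toFinset, hT]
    exact Finset.mem_insert_of_mem (Finset.mem_singleton_self w)
  rw [hT, Finset.sum_pair hvw] at hsum
  have h1 := hfoldc v hv
  have h2 := hfoldc w hw
  have h3 := count_criticalValues h.pos_c v
  have h4 := count_criticalValues h.pos_c w
  exact Or.inr (Or.inr ⟨v, w, hvw, (hbranch v hv).1, (hbranch w hw).1,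
    ⟨by omega, (hbranch v hv).2⟩, ⟨by omega, (hbranch w hw).2⟩⟩)

end CoprimeCross

theorem exists_comp_X_pow {p : ℕ} (hp : 0 < p) {f : ℂ[X]} (h : ∀ i, ¬ p ∣ i → f.coeff i = 0) :
    ∃ g : ℂ[X], f = g.comp (X ^ p) := by
  refine ⟨contract p f, ?_⟩
  rw [← expand_eq_comp_X_pow]
  ext i
  rw [coeff_expand hp]
  split_ifs with hi
  · rw [coeff_contract hp.ne', Nat.div_mul_cancel hi]
  · exact h i hi

theorem exists_scalar_of_pow_eq_pow {p : ℕ} (hp : 0 < p) {f g : ℂ[X]} (h : f ^ p = g ^ p) :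
    ∃ e : ℂ, f = C e * g := by
  have hζ := (Complex.isPrimitiveRoot_exp p hp.ne').map_of_injective (C_injective (R := ℂ))
  have h1 := hζ.pow_sub_pow_eq_prod_sub_mul f g hp
  rw [h, sub_self, eq_comm, Finset.prod_eq_zero_iff] at h1
  obtain ⟨η, hη, h2⟩ := h1
  rw [mem_nthRootsFinset hp] at hη
  have hdeg : η.natDegree = 0 := by
    have := congrArg natDegree hη
    rw [natDegree_pow, natDegree_one] at this
    exact (Nat.mul_eq_zero.1 this).resolve_left hp.ne'
  obtain ⟨e, rfl⟩ := natDegree_eq_zero.1 hdeg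
  exact ⟨e, sub_eq_zero.1 h2⟩

theorem comp_X_pow_natDegree_pos {p : ℕ} (hp : 0 < p) : 0 < (X ^ p : ℂ[X]).natDegree := by
  rwa [natDegree_X_pow]

theorem exists_eq_of_pow_eq_comp {p : ℕ} (hp : 0 < p) {B R : ℂ[X]} (hB : B ≠ 0)
    (h : (X ^ p : ℂ[X]).comp B = R.comp (X ^ p)) :
    ∃ (t : ℂ) (k : ℕ) (u : ℂ[X]), t ≠ 0 ∧ u.Monic ∧ u.eval 0 ≠ 0 ∧
      B = C t * (X ^ k * u.comp (X ^ p)) ∧ R = C (t ^ p) * (X ^ k * u ^ p) := by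
  have hBp : B ^ p = R.comp (X ^ p) := by rw [← h, X_pow_comp]
  have hζ := Complex.isPrimitiveRoot_exp p hp.ne'
  set ζ := Complex.exp (2 * Real.pi * Complex.I / p)
  obtain ⟨e, he⟩ : ∃ e : ℂ, B.comp (C ζ * X) = C e * B := by
    refine exists_scalar_of_pow_eq_pow hp ?_
    rw [← pow_comp, hBp, comp_assoc, X_pow_comp, mul_pow, ← C_pow, hζ.pow_eq_one, C_1, one_mul]
  have hcoeff : ∀ i, B.coeff i * ζ ^ i = e * B.coeff i := by
    intro i
    have := congrArg (fun f : ℂ[X] => f.coeff i) he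
    simpa only [comp_C_mul_X_coeff, coeff_C_mul] using this
  obtain ⟨U, hU, hU0⟩ := exists_eq_pow_rootMultiplicity_mul_and_not_dvd B hB 0
  set k := B.rootMultiplicity 0
  rw [C_0, sub_zero] at hU hU0
  rw [X_dvd_iff] at hU0
  have hUc : ∀ i, U.coeff i = B.coeff (i + k) := fun i => by
    conv_rhs => rw [hU, coeff_X_pow_mul]
  have hek : ζ ^ k = e := by
    have := hcoeff k
    have hk := hUc 0
    rw [zero_add] at hk
    rw [mul_comm] at this
    exact mul_right_cancel₀ (hk ▸ hU0) this
  obtain ⟨V, hV⟩ : ∃ V : ℂ[X], U = V.comp (X ^ p) := by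
    refine exists_comp_X_pow hp fun i hi => ?_
    by_contra hne
    have h1 := hcoeff (i + k)
    rw [← hUc, mul_comm, pow_add, hek] at h1
    have h2 := mul_right_cancel₀ hne h1
    have he0 : e ≠ 0 := hek ▸ pow_ne_zero _ (hζ.ne_zero hp.ne')
    have h3 : ζ ^ i = 1 := mul_right_cancel₀ he0 (by rw [h2, one_mul])
    exact hi ((hζ.pow_eq_one_iff_dvd i).1 h3)
  have hV0 : V.eval 0 ≠ 0 := by
    rw [coeff_zero_eq_eval_zero, hV, eval_comp] at hU0
    simpa [hp.ne'] using hU0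
  have hVne : V ≠ 0 := by
    rintro rfl
    simp at hV0
  set t := V.leadingCoeff with ht
  have ht0 : t ≠ 0 := leadingCoeff_ne_zero.2 hVne
  have hVu : V = C t * (C t⁻¹ * V) := by
    rw [← mul_assoc, ← C_mul, mul_inv_cancel₀ ht0, C_1, one_mul]
  have hBe : B = C t * (X ^ k * (C t⁻¹ * V).comp (X ^ p)) := by
    have h1 : V.comp (X ^ p) = C t * (C t⁻¹ * V).comp (X ^ p) := by
      conv_lhs => rw [hVu, mul_comp, C_comp]
    conv_lhs => rw [hU, hV, h1]
    ring
  refine ⟨t, k, C t⁻¹ * V, ht0, ?_, ?_, hBe, ?_⟩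
  · rw [Monic, leadingCoeff_mul, leadingCoeff_C, ← ht, inv_mul_cancel₀ ht0]
  · rw [eval_mul, eval_C]
    exact mul_ne_zero (inv_ne_zero ht0) hV0
  · refine comp_right_cancel (comp_X_pow_natDegree_pos hp) ?_
    rw [← hBp, hBe]
    simp only [mul_comp, C_comp, pow_comp, X_comp, mul_pow, C_pow]
    rw [← pow_mul, ← pow_mul, mul_comm k p]

theorem Indecomposable.prime_of_X_pow {n : ℕ} (h : Indecomposable (X ^ n : ℂ[X])) : n.Prime := by
  have hn := h.1
  rw [natDegree_X_pow] at hn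
  refine Nat.prime_def.2 ⟨hn, fun q hq => ?_⟩
  obtain ⟨r, rfl⟩ := hq
  by_contra! hne
  have hq2 : 2 ≤ q := by
    rcases q with _ | _ | q
    · omega
    · exact absurd rfl hne.1
    · omega
  have hr2 : 2 ≤ r := by
    rcases r with _ | _ | r
    · omega
    · exact absurd (mul_one q).symm hne.2
    · omega
  exact h.2 ⟨X ^ q, X ^ r, by rwa [natDegree_X_pow], by rwa [natDegree_X_pow],
    by rw [X_pow_comp, ← pow_mul, mul_comm]⟩

/-- `A ∘ B` and `R ∘ S` arise from `a ∘ b` and `c ∘ d` by compatible linear changes of variable. -/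
def LinearlyRelated (a b c d A B R S : ℂ[X]) : Prop :=
  ∃ L M N M' : ℂ[X], IsLinearPoly L ∧ IsLinearPoly M ∧ IsLinearPoly N ∧ IsLinearPoly M' ∧
    L.comp A = a.comp M ∧ M.comp B = b.comp N ∧ L.comp R = c.comp M' ∧ M'.comp S = d.comp N

theorem Indecomposable.of_comp_eq {L M p q : ℂ[X]} (hL : IsLinearPoly L) (hM : IsLinearPoly M)
    (hq : Indecomposable q) (h : L.comp p = q.comp M) : Indecomposable p := by
  obtain ⟨L', hL', -, hLL⟩ := hL.exists_inverse
  have h1 : p = L'.comp (q.comp M) := by rw [← h, ← comp_assoc, hLL, X_comp]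
  rw [h1]
  exact (hq.comp_right hM).comp_left hL'

theorem exists_comp_X_pow_eq_of_card_fiber {g : ℂ[X]} (hg : 0 < g.natDegree) {v z : ℂ}
    (h : fiber g v = {z}) :
    (C g.leadingCoeff * X + C v).comp (X ^ g.natDegree) = g.comp (X + C z) := by
  have h1 := sub_C_eq_prod hg v
  have h2 := sum_ramIndex hg v
  rw [h, Finset.sum_singleton] at h2
  rw [h, Finset.prod_singleton, h2] at h1
  have h3 := congrArg (fun f : ℂ[X] => f.comp (X + C z)) (sub_eq_iff_eq_add.1 h1)
  rw [h3]
  simp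

namespace CoprimeCross

variable {a b c d : ℂ[X]}

theorem exists_fiber_eq_singleton (h : CoprimeCross a b c d) (hp : a.natDegree.Prime) {v x : ℂ}
    (hx : fiber a v = {x}) : ∃ y z, fiber d y = {z} := by
  obtain ⟨y, hy, hndvd⟩ : ∃ y ∈ fiber c v, ¬ a.natDegree ∣ ramIndex c y := by
    by_contra! hall
    have h1 := Finset.dvd_sum hall
    rw [sum_ramIndex h.pos_c, h.natDegree_c] at h1
    exact hp.one_lt.ne' (Nat.eq_one_of_dvd_coprimes h.coprime dvd_rfl h1)
  have hram : ramIndex a x = a.natDegree := by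
    rw [← sum_ramIndex h.pos_a v, hx, Finset.sum_singleton]
  have hxv : a.eval x = v := (mem_fiber h.pos_a).1 (hx ▸ Finset.mem_singleton_self x)
  have hyv := (mem_fiber h.pos_c).1 hy
  have hcard := h.card_filter_le_gcd (x := x) (y := y) (hxv.trans hyv.symm)
  rw [hram, (Nat.Prime.coprime_iff_not_dvd hp).2 hndvd] at hcard
  have hsub : fiber d y ⊆ (fiber b x).filter fun z => d.eval z = y := by
    intro z hz
    rw [mem_fiber h.pos_d] at hz
    rw [Finset.mem_filter, mem_fiber h.pos_b]
    refine ⟨?_, hz⟩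
    have : b.eval z ∈ fiber a v := by rw [mem_fiber h.pos_a, h.eval_eq, hz, hyv]
    rwa [hx, Finset.mem_singleton] at this
  have h1 := (fiber_nonempty h.pos_d y).card_pos
  have h2 := Finset.card_le_card hsub
  obtain ⟨z, hz⟩ := Finset.card_eq_one.1 (show (fiber d y).card = 1 by omega)
  exact ⟨y, z, hz⟩

theorem exists_of_card_fiber_eq_one (h : CoprimeCross a b c d) (ha : Indecomposable a) {v : ℂ}
    (hv : (fiber a v).card = 1) :
    ∃ (p k : ℕ) (u : ℂ[X]), p.Prime ∧ u.Monic ∧ u.eval 0 ≠ 0 ∧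
      LinearlyRelated a b c d (X ^ p) (X ^ k * u.comp (X ^ p)) (X ^ k * u ^ p) (X ^ p) := by
  obtain ⟨x, hx⟩ := Finset.card_eq_one.1 hv
  have hrel := exists_comp_X_pow_eq_of_card_fiber h.pos_a hx
  have hla : a.leadingCoeff ≠ 0 := leadingCoeff_ne_zero.2 (ne_zero_of_natDegree_gt h.pos_a)
  have hld : d.leadingCoeff ≠ 0 := leadingCoeff_ne_zero.2 (ne_zero_of_natDegree_gt h.pos_d)
  have hL := IsLinearPoly.C_mul_X_add_C hla v
  have hM : IsLinearPoly (X + C x : ℂ[X]) := natDegree_X_add_C x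
  have hp := (Indecomposable.of_comp_eq hL hM ha hrel).prime_of_X_pow
  obtain ⟨y, z, hyz⟩ := h.exists_fiber_eq_singleton hp hx
  have hrel' := exists_comp_X_pow_eq_of_card_fiber h.pos_d hyz
  rw [h.natDegree_d] at hrel'
  have hM' := IsLinearPoly.C_mul_X_add_C hld y
  have hN : IsLinearPoly (X + C z : ℂ[X]) := natDegree_X_add_C z
  set L : ℂ[X] := C a.leadingCoeff * X + C v
  set M : ℂ[X] := X + C x
  set M' : ℂ[X] := C d.leadingCoeff * X + C y
  set N : ℂ[X] := X + C z
  set p := a.natDegree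
  obtain ⟨L', hL', hLL', hL'L⟩ := hL.exists_inverse
  obtain ⟨W, hW, hMW, hWM⟩ := hM.exists_inverse
  have hBR : (X ^ p : ℂ[X]).comp (W.comp (b.comp N)) = (L'.comp (c.comp M')).comp (X ^ p) := by
    have h1 : (X ^ p : ℂ[X]) = L'.comp (a.comp M) := by
      rw [← hrel, ← comp_assoc, hL'L, X_comp]
    calc (X ^ p : ℂ[X]).comp (W.comp (b.comp N))
        = L'.comp (a.comp ((M.comp W).comp (b.comp N))) := by
          rw [h1]; simp only [comp_assoc]
      _ = L'.comp ((a.comp b).comp N) := by rw [hMW, X_comp, comp_assoc]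
      _ = L'.comp (c.comp (d.comp N)) := by rw [h.comp_eq, comp_assoc]
      _ = _ := by rw [← hrel']; simp only [comp_assoc]
  have hB0 : W.comp (b.comp N) ≠ 0 := by
    refine ne_zero_of_natDegree_gt (n := 0) ?_
    rw [hW.natDegree_comp_left, hN.natDegree_comp_right]
    exact h.pos_b
  obtain ⟨t, k, u, ht, hu, hu0, hB, hR⟩ := exists_eq_of_pow_eq_comp hp.pos hB0 hBR
  have hT := IsLinearPoly.C_mul_X_add_C ht 0
  have hTp := IsLinearPoly.C_mul_X_add_C (pow_ne_zero p ht) 0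
  refine ⟨p, k, u, hp, hu, hu0, L.comp (C (t ^ p) * X + C 0), M.comp (C t * X + C 0), N, M',
    hL.comp hTp, hM.comp hT, hN, hM', ?_, ?_, ?_, hrel'⟩
  · rw [← comp_assoc a, ← hrel, comp_assoc, comp_assoc]
    congr 1
    simp [mul_pow]
  · rw [comp_assoc, show (C t * X + C 0 : ℂ[X]).comp (X ^ k * u.comp (X ^ p)) =
      W.comp (b.comp N) by rw [hB]; simp, ← comp_assoc, hMW, X_comp]
  · rw [comp_assoc, show (C (t ^ p) * X + C 0 : ℂ[X]).comp (X ^ k * u ^ p) =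
      L'.comp (c.comp M') by rw [hR]; simp, ← comp_assoc, hLL', X_comp]

end CoprimeCross

theorem IsRitty.of_eq {f u : ℂ[X]} {k el n : ℕ} (hf : Indecomposable f) (hk : 1 ≤ k)
    (hel : 1 ≤ el) (hn : 1 ≤ n) (hkl : Nat.gcd k el = 1) (hkn : Nat.gcd k n = 1) (hu : u.Monic)
    (hu1 : 0 < u.natDegree) (hu0 : u.eval 0 ≠ 0) (hln : 1 < el ∨ 1 < n)
    (h : f = X ^ k * (u.comp (X ^ el)) ^ n) : IsRitty f :=
  ⟨hf, Or.inr (Or.inr (Or.inr ⟨k, el, n, u, hk, hel, hn, hkl, hkn, hu, hu1, hu0, hln, h⟩))⟩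

theorem basicRittIdentity_of_pow {p k : ℕ} {u : ℂ[X]} (hp : p.Prime) (hu : u.Monic)
    (hu0 : u.eval 0 ≠ 0) (hB : Indecomposable (X ^ k * u.comp (X ^ p)))
    (hR : Indecomposable (X ^ k * u ^ p))
    (hcop : Nat.Coprime p (X ^ k * u ^ p).natDegree) :
    BasicRittIdentity (X ^ p) (X ^ k * u.comp (X ^ p)) (X ^ k * u ^ p) (X ^ p) ∧
    BasicRittIdentity (X ^ k * u ^ p) (X ^ p) (X ^ p) (X ^ k * u.comp (X ^ p)) := by
  have hcomp : (X ^ p : ℂ[X]).comp (X ^ k * u.comp (X ^ p)) = (X ^ k * u ^ p).comp (X ^ p) := by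
    simp only [mul_comp, pow_comp, X_comp, mul_pow]
    rw [← pow_mul, ← pow_mul, mul_comm p k]
  rw [natDegree_mul (pow_ne_zero _ X_ne_zero) (pow_ne_zero _ hu.ne_zero), natDegree_X_pow,
    natDegree_pow, Nat.coprime_add_mul_left_right] at hcop
  rcases Nat.eq_zero_or_pos u.natDegree with hu1 | hu1
  · have h1 : u = 1 := hu.natDegree_eq_zero.1 hu1
    subst h1
    simp only [one_comp, one_pow, mul_one] at hB hR hcomp ⊢
    have hk := hB.prime_of_X_pow
    have hne : p ≠ k := by
      rintro rfl
      exact hp.one_lt.ne' ((Nat.coprime_self p).1 hcop)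
    exact ⟨⟨hcomp, Or.inl ⟨p, k, hp, hk, hne, rfl, rfl, rfl, rfl⟩⟩,
      ⟨hcomp.symm, Or.inl ⟨k, p, hk, hp, hne.symm, rfl, rfl, rfl, rfl⟩⟩⟩
  · have hk : 1 ≤ k := by
      rcases Nat.eq_zero_or_pos k with rfl | hk
      · exact absurd ((Nat.coprime_zero_right p).1 hcop) hp.one_lt.ne'
      · exact hk
    have hBr : IsRitty (X ^ k * u.comp (X ^ p)) := IsRitty.of_eq (n := 1) hB hk hp.one_le le_rfl
      hcop.symm (Nat.gcd_one_right k) hu hu1 hu0 (Or.inl hp.one_lt) (by rw [pow_one])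
    have hRr : IsRitty (X ^ k * u ^ p) := IsRitty.of_eq (el := 1) hR hk le_rfl hp.one_le
      (Nat.gcd_one_right k) hcop.symm hu hu1 hu0 (Or.inr hp.one_lt) (by rw [pow_one, comp_X])
    refine ⟨⟨hcomp, Or.inr (Or.inr (Or.inl ⟨p, k, 1, 1, u, hp, rfl, ?_, ?_, rfl, hBr, hRr⟩))⟩,
      ⟨hcomp.symm, Or.inr (Or.inr (Or.inr ⟨p, k, 1, 1, u, hp, ?_, rfl, rfl, ?_, hRr, hBr⟩))⟩⟩ <;>
    simp only [one_mul, mul_one, pow_one, comp_X]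

theorem exists_add_inv (x : ℂ) : ∃ w : ℂ, w ≠ 0 ∧ w + w⁻¹ = x := by
  obtain ⟨w, hw⟩ := IsAlgClosed.exists_root (X ^ 2 - C x * X + 1 : ℂ[X])
    (by rw [show (X ^ 2 - C x * X + 1 : ℂ[X]) = C 1 * X ^ 2 + C (-x) * X + C 1 by simp; ring,
      degree_quadratic one_ne_zero]; norm_num)
  simp only [IsRoot.def, eval_add, eval_sub, eval_pow, eval_mul, eval_X, eval_C, eval_one] at hw
  have hw0 : w ≠ 0 := by
    rintro rfl
    norm_num at hw
  refine ⟨w, hw0, ?_⟩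
  field_simp
  linear_combination hw

namespace IsChebyshev

variable {n : ℕ} {f g : ℂ[X]}

theorem unique (hf : IsChebyshev n f) (hg : IsChebyshev n g) : f = g := by
  refine Polynomial.funext fun x => ?_
  obtain ⟨w, hw, rfl⟩ := exists_add_inv x
  rw [hf w hw, hg w hw]

theorem dickson (n : ℕ) : IsChebyshev n (dickson 1 (1 : ℂ) n) := fun x hx =>
  dickson_one_one_eval_add_inv x x⁻¹ (mul_inv_cancel₀ hx) n

theorem natDegree_eq (hf : IsChebyshev n f) : f.natDegree = n := by
  rw [hf.unique (dickson n), dickson_one_one_eq_chebyshev_C]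
  have h := congrArg natDegree (Chebyshev.C_comp_two_mul_X ℂ n)
  have h2 : (2 : ℂ[X]) = C 2 := rfl
  rw [natDegree_comp, h2, natDegree_C_mul_X _ two_ne_zero, natDegree_C_mul two_ne_zero,
    Chebyshev.natDegree_T, mul_one, Int.natAbs_natCast] at h
  exact h

theorem comp {k : ℕ} (hf : IsChebyshev n f) (hg : IsChebyshev k g) :
    IsChebyshev (n * k) (f.comp g) := by
  intro x hx
  rw [eval_comp, hg x hx, inv_pow, hf _ (pow_ne_zero k hx), ← inv_pow, ← pow_mul, ← pow_mul,
    mul_comm]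

theorem prime (hf : IsChebyshev n f) (h : Indecomposable f) : n.Prime := by
  have hn := h.1
  rw [hf.natDegree_eq] at hn
  refine Nat.prime_def.2 ⟨hn, fun q hq => ?_⟩
  obtain ⟨r, rfl⟩ := hq
  by_contra! hne
  have hq2 : 2 ≤ q := by
    rcases q with _ | _ | q
    · omega
    · exact absurd rfl hne.1
    · omega
  have hr2 : 2 ≤ r := by
    rcases r with _ | _ | r
    · omega
    · exact absurd (mul_one q).symm hne.2
    · omega
  exact h.2 ⟨_, _, hq2.trans (dickson q).natDegree_eq.ge, hr2.trans (dickson r).natDegree_eq.ge,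
    hf.unique ((dickson q).comp (dickson r))⟩

end IsChebyshev

theorem exists_eval_eq_pow_mul_eval_add_inv (g : ℂ[X]) :
    ∃ (e : ℕ) (H : ℂ[X]), ∀ w : ℂ, w ≠ 0 → H.eval w = w ^ e * g.eval (w + w⁻¹) := by
  induction g using Polynomial.induction_on' with
  | add p q hp hq =>
    obtain ⟨e, H, hH⟩ := hp
    obtain ⟨e', H', hH'⟩ := hq
    refine ⟨e + e', X ^ e' * H + X ^ e * H', fun w hw => ?_⟩
    rw [eval_add, eval_mul, eval_mul, hH w hw, hH' w hw, eval_add, eval_X_pow, eval_X_pow]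
    ring
  | monomial n a =>
    refine ⟨n, C a * (X ^ 2 + 1) ^ n, fun w hw => ?_⟩
    simp only [eval_mul, eval_C, eval_pow, eval_add, eval_X, eval_one, eval_monomial]
    rw [mul_left_comm, ← mul_pow]
    congr 2
    field_simp

theorem exists_isChebyshev_of_sq {g P : ℂ[X]} (h : g ^ 2 - 4 = (X ^ 2 - 4) * P ^ 2)
    (h2 : g.eval 2 = 2) : ∃ l, IsChebyshev l g := by
  obtain ⟨e, H, hH⟩ := exists_eval_eq_pow_mul_eval_add_inv g
  obtain ⟨e', K, hK⟩ := exists_eval_eq_pow_mul_eval_add_inv P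
  set H' : ℂ[X] := X ^ (e' + 1) * H with hH'
  set K' : ℂ[X] := X ^ e * (X ^ 2 - 1) * K with hK'
  set s := e + e' + 1 with hs
  have hHe : ∀ w : ℂ, w ≠ 0 → H'.eval w = w ^ s * g.eval (w + w⁻¹) := by
    intro w hw
    rw [hH', eval_mul, hH w hw, eval_X_pow, hs]
    ring
  have hKe : ∀ w : ℂ, w ≠ 0 → K'.eval w = w ^ s * ((w - w⁻¹) * P.eval (w + w⁻¹)) := by
    intro w hw
    rw [hK', eval_mul, eval_mul, hK w hw, eval_X_pow, hs, eval_sub, eval_X_pow, eval_one]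
    field_simp
    ring
  have hmul : (H' + K') * (H' - K') = C 4 * X ^ (2 * s) := by
    refine eq_of_infinite_eval_eq _ _ (Set.Infinite.mono (s := {0}ᶜ) ?_
      (Set.finite_singleton (0 : ℂ)).infinite_compl)
    intro w hw
    have hw : w ≠ 0 := hw
    have h3 := congrArg (eval (w + w⁻¹)) h
    simp only [eval_sub, eval_pow, eval_mul, eval_X, eval_ofNat] at h3
    rw [Set.mem_ofPred_eq, eval_mul, eval_add, eval_sub, hHe w hw, hKe w hw, eval_mul, eval_C,
      eval_X_pow]
    have h4 : (w + w⁻¹) ^ 2 - 4 = (w - w⁻¹) ^ 2 := by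
      field_simp
      ring
    rw [h4] at h3
    linear_combination (w ^ s) ^ 2 * h3
  have hfac : ∀ F : ℂ[X], F ∣ C 4 * X ^ (2 * s) → ∃ (i : ℕ) (u : ℂ), F = C u * X ^ i := by
    intro F hF
    rw [(isUnit_C.2 (isUnit_iff_ne_zero.2 (by norm_num))).dvd_mul_left, dvd_prime_pow prime_X] at hF
    obtain ⟨i, -, hi⟩ := hF
    obtain ⟨u, hu⟩ := hi.symm
    obtain ⟨t, -, ht⟩ := isUnit_iff.1 u.isUnit
    exact ⟨i, t, by rw [← hu, ht, mul_comm]⟩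
  obtain ⟨i, u, hu⟩ := hfac _ (Dvd.intro _ hmul)
  obtain ⟨j, v, hv⟩ := hfac _ (Dvd.intro_left _ hmul)
  have huv : u * v = 4 ∧ i + j = 2 * s := by
    rw [hu, hv] at hmul
    have h3 : C (u * v) * X ^ (i + j) = (C 4 * X ^ (2 * s) : ℂ[X]) := by
      rw [← hmul, C_mul, pow_add]
      ring
    have h4 : u * v = 4 := by
      have := congrArg (eval 1) h3
      simpa using this
    refine ⟨h4, ?_⟩
    have := congrArg natDegree h3
    rwa [h4, natDegree_C_mul_X_pow _ _ (by norm_num), natDegree_C_mul_X_pow _ _ (by norm_num)]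
      at this
  have hsum : ∀ w : ℂ, w ≠ 0 → w ^ s * g.eval (w + w⁻¹) = (u * w ^ i + v * w ^ j) / 2 := by
    intro w hw
    have h3 := congrArg (eval w) (congrArg₂ (· + ·) hu hv)
    simp only [eval_add, eval_sub, eval_mul, eval_C, eval_X_pow] at h3
    rw [← hHe w hw]
    linear_combination h3 / 2
  have hu2 : u + v = 4 := by
    have h3 := hsum 1 one_ne_zero
    rw [inv_one, one_add_one_eq_two, h2] at h3
    simp only [one_pow, mul_one, one_mul] at h3
    linear_combination -2 * h3
  have hu_eq : u = 2 := by
    have : (u - 2) ^ 2 = 0 := by linear_combination u * hu2 - huv.1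
    exact sub_eq_zero.1 (pow_eq_zero_iff two_ne_zero |>.1 this)
  have hv_eq : v = 2 := by linear_combination hu2 - hu_eq
  have hval : ∀ w : ℂ, w ≠ 0 → w ^ s * g.eval (w + w⁻¹) = w ^ i + w ^ j := by
    intro w hw
    rw [hsum w hw, hu_eq, hv_eq]
    ring
  have hgen : ∀ k l : ℕ, k + l = 2 * s → s ≤ k →
      (∀ w : ℂ, w ≠ 0 → w ^ s * g.eval (w + w⁻¹) = w ^ k + w ^ l) → ∃ l, IsChebyshev l g := by
    intro k l hkl hsk hw
    obtain ⟨t, rfl⟩ := Nat.exists_eq_add_of_le hsk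
    have hlt : s = l + t := by omega
    rw [hlt] at hw
    refine ⟨t, fun w hw0 => ?_⟩
    refine mul_left_cancel₀ (pow_ne_zero (l + t) hw0) ?_
    rw [hw w hw0]
    have : w ^ t * w⁻¹ ^ t = 1 := by rw [← mul_pow, mul_inv_cancel₀ hw0, one_pow]
    rw [mul_add, pow_add _ l t, mul_assoc, mul_assoc, this]
    ring
  rcases le_total s i with hi | hi
  · exact hgen i j huv.2 hi hval
  · refine hgen j i (by omega) (by omega) fun w hw => ?_
    rw [hval w hw, add_comm]

/-- The linear polynomial taking the values `s` at `2` and `t` at `-2`. -/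
def lineThrough (s t : ℂ) : ℂ[X] :=
  C ((s - t) / 4) * X + C ((s + t) / 2)

theorem isLinearPoly_lineThrough {s t : ℂ} (h : s ≠ t) : IsLinearPoly (lineThrough s t) :=
  IsLinearPoly.C_mul_X_add_C (div_ne_zero (sub_ne_zero.2 h) (by norm_num)) _

theorem IsFolded.exists_eq {g : ℂ[X]} (hg : 0 < g.natDegree) {v p : ℂ} (h : IsFolded g v)
    (hp : simpleFiber g v = {p}) : ∃ A : ℂ[X], g - C v = C g.leadingCoeff * ((X - C p) * A ^ 2) := by
  have hmem : p ∈ simpleFiber g v := hp ▸ Finset.mem_singleton_self p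
  rw [simpleFiber, Finset.mem_filter] at hmem
  refine ⟨∏ z ∈ (fiber g v).erase p, (X - C z), ?_⟩
  rw [sub_C_eq_prod hg, ← Finset.mul_prod_erase _ _ hmem.1, hmem.2, pow_one, ← Finset.prod_pow]
  congr 2
  refine Finset.prod_congr rfl fun z hz => ?_
  rw [Finset.mem_erase] at hz
  have h1 := h.2 z hz.2
  have h2 := ramIndex_pos hg z
  have h3 : ramIndex g z ≠ 1 := fun h3 => hz.1 <| by
    have : z ∈ simpleFiber g v := Finset.mem_filter.2 ⟨hz.2, h3⟩
    rwa [hp, Finset.mem_singleton] at this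
  rw [show ramIndex g z = 2 by omega]

theorem IsFolded.exists_isChebyshev {g : ℂ[X]} (hg : 0 < g.natDegree) {v w p q : ℂ} (hvw : v ≠ w)
    (hv : IsFolded g v) (hw : IsFolded g w) (hp : simpleFiber g v = {p})
    (hq : simpleFiber g w = {q}) :
    p ≠ q ∧ ∃ T, IsChebyshev g.natDegree T ∧
      (lineThrough v w).comp T = g.comp (lineThrough p q) := by
  obtain ⟨A, hA⟩ := hv.exists_eq hg hp
  obtain ⟨B, hB⟩ := hw.exists_eq hg hq
  have hgp : g.eval p = v := by
    have := congrArg (eval p) hA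
    simpa [sub_eq_zero] using this
  have hgq : g.eval q = w := by
    have := congrArg (eval q) hB
    simpa [sub_eq_zero] using this
  have hpq : p ≠ q := by
    rintro rfl
    exact hvw (hgp.symm.trans hgq)
  refine ⟨hpq, ?_⟩
  have hvw' : v - w ≠ 0 := sub_ne_zero.2 hvw
  obtain ⟨T, hT⟩ : ∃ T : ℂ[X], T =
      C (4 / (v - w)) * (g.comp (lineThrough p q) - C ((v + w) / 2)) := ⟨_, rfl⟩
  have hrel : (lineThrough v w).comp T = g.comp (lineThrough p q) := by
    rw [hT, lineThrough, add_comp, mul_comp, C_comp, X_comp, C_comp, ← mul_assoc, ← C_mul,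
      div_mul_div_cancel₀' hvw', div_self (by norm_num), C_1, one_mul, sub_add_cancel]
  have heval : ∀ x : ℂ, T.eval x = 4 / (v - w) * (g.eval ((lineThrough p q).eval x) -
      (v + w) / 2) := fun x => by
    rw [hT, eval_mul, eval_C, eval_sub, eval_C, eval_comp]
  have hsq : T ^ 2 - 4 = (X ^ 2 - 4) *
      (C (g.leadingCoeff * (p - q) / (v - w)) * (A * B).comp (lineThrough p q)) ^ 2 := by
    refine Polynomial.funext fun x => ?_
    have hx : (lineThrough p q).eval x = (p - q) / 4 * x + (p + q) / 2 := by simp [lineThrough]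
    have h1 := congrArg (eval ((lineThrough p q).eval x)) hA
    have h2 := congrArg (eval ((lineThrough p q).eval x)) hB
    simp only [eval_sub, eval_mul, eval_pow, eval_C, eval_X, eval_comp, eval_ofNat, heval] at h1 h2 ⊢
    rw [sub_eq_iff_eq_add] at h1
    have h3 : g.eval ((lineThrough p q).eval x) - (v + w) / 2 =
      g.leadingCoeff * (((lineThrough p q).eval x - p) * A.eval ((lineThrough p q).eval x) ^ 2) +
        (v - w) / 2 := by rw [h1]; ring
    have h4 : g.leadingCoeff * (((lineThrough p q).eval x - p) *
        A.eval ((lineThrough p q).eval x) ^ 2) + (v - w) = g.leadingCoeff *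
        (((lineThrough p q).eval x - q) * B.eval ((lineThrough p q).eval x) ^ 2) := by
      rw [← h2, h1]; ring
    set Y := (lineThrough p q).eval x
    have h5 : Y - p = (p - q) / 4 * (x - 2) := by rw [hx]; ring
    have h6 : Y - q = (p - q) / 4 * (x + 2) := by rw [hx]; ring
    rw [h3]
    rw [h5, h6] at h4
    rw [h5]
    field_simp
    linear_combination (g.leadingCoeff * (p - q) * (x - 2) * A.eval Y ^ 2) * 16 * h4
  have hT2 : T.eval 2 = 2 := by
    have hx : (lineThrough p q).eval 2 = p := by simp [lineThrough]; ring
    rw [heval, hx, hgp]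
    field_simp
    ring
  obtain ⟨l, hl⟩ := exists_isChebyshev_of_sq hsq hT2
  have hdeg : l = g.natDegree := by
    rw [← hl.natDegree_eq, ← (isLinearPoly_lineThrough hvw).natDegree_comp_left, hrel,
      (isLinearPoly_lineThrough hpq).natDegree_comp_right]
  exact ⟨T, hdeg ▸ hl, hrel⟩

namespace CoprimeCross

variable {a b c d : ℂ[X]}

theorem isFolded_of_simple (h : CoprimeCross a b c d) {v x : ℂ} (hx : x ∈ simpleFiber a v)
    (hc : IsFolded c v) : IsFolded b x := by
  rw [simpleFiber, Finset.mem_filter, mem_fiber h.pos_a] at hx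
  obtain ⟨hxv, hx1⟩ := hx
  have hram : ∀ z ∈ fiber b x, ramIndex b z ≤ 2 := by
    intro z hz
    have hzx := (mem_fiber h.pos_b).1 hz
    have h1 := h.sum_ramIndex_eq (x := x) (y := d.eval z) (by rw [← h.eval_eq, hzx])
    have h2 := Finset.single_le_sum (f := fun z => ramIndex b z) (fun _ _ => Nat.zero_le _)
      (Finset.mem_filter.2 ⟨hz, rfl⟩ : z ∈ (fiber b x).filter fun w => d.eval w = d.eval z)
    have h3 := hc.2 (d.eval z) (by rw [mem_fiber h.pos_c, ← h.eval_eq, hzx, hxv])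
    have h4 : ramIndex b z ≤ ramIndex c (d.eval z) := h2.trans_eq h1
    omega
  refine ⟨?_, hram⟩
  have h1 := (two_mul_card_fiber_le h.pos_b x).2.2 hram
  have h2 := (two_mul_card_fiber_le h.pos_c v).2.2 hc.2
  have h3 := h.count_criticalValues_le hx1
  rw [hxv] at h3
  have h4 := count_criticalValues h.pos_b x
  have h5 := count_criticalValues h.pos_c v
  have h6 := h.natDegree_c
  rw [hc.1] at h2
  omega

theorem simpleFiber_eq (h : CoprimeCross a b c d) {v x y z : ℂ} (hx : simpleFiber a v = {x})
    (hy : simpleFiber c v = {y}) (hz : simpleFiber b x = {z}) (hd : IsFolded d y) :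
    simpleFiber d y = {z} := by
  have hx' : x ∈ simpleFiber a v := hx ▸ Finset.mem_singleton_self x
  have hz' : z ∈ simpleFiber b x := hz ▸ Finset.mem_singleton_self z
  rw [simpleFiber, Finset.mem_filter, mem_fiber h.pos_a] at hx'
  rw [simpleFiber, Finset.mem_filter, mem_fiber h.pos_b] at hz'
  have h1 := h.ramIndex_mul z
  rw [hz'.1, hx'.2, hz'.2, one_mul] at h1
  replace h1 := And.intro (Nat.eq_one_of_mul_eq_one_right h1.symm)
    (Nat.eq_one_of_mul_eq_one_left h1.symm)
  have h2 : d.eval z ∈ simpleFiber c v := by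
    rw [simpleFiber, Finset.mem_filter, mem_fiber h.pos_c, ← h.eval_eq, hz'.1]
    exact ⟨hx'.1, h1.1⟩
  rw [hy, Finset.mem_singleton] at h2
  obtain ⟨w, hw⟩ := Finset.card_eq_one.1 hd.1
  have h3 : z ∈ simpleFiber d y := by
    rw [simpleFiber, Finset.mem_filter, mem_fiber h.pos_d]
    exact ⟨h2, h1.2⟩
  rw [hw, Finset.mem_singleton] at h3
  rw [hw, h3]

theorem exists_of_isFolded (h : CoprimeCross a b c d) {v w : ℂ} (hvw : v ≠ w)
    (hav : IsFolded a v) (haw : IsFolded a w) (hcv : IsFolded c v) (hcw : IsFolded c w) :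
    ∃ T U : ℂ[X], IsChebyshev a.natDegree T ∧ IsChebyshev b.natDegree U ∧
      LinearlyRelated a b c d T U U T := by
  obtain ⟨p, hp⟩ := Finset.card_eq_one.1 hav.1
  obtain ⟨q, hq⟩ := Finset.card_eq_one.1 haw.1
  obtain ⟨p', hp'⟩ := Finset.card_eq_one.1 hcv.1
  obtain ⟨q', hq'⟩ := Finset.card_eq_one.1 hcw.1
  have hbp := h.isFolded_of_simple (hp ▸ Finset.mem_singleton_self p) hcv
  have hbq := h.isFolded_of_simple (hq ▸ Finset.mem_singleton_self q) hcw
  have hdp := h.symm.isFolded_of_simple (hp' ▸ Finset.mem_singleton_self p') hav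
  have hdq := h.symm.isFolded_of_simple (hq' ▸ Finset.mem_singleton_self q') haw
  obtain ⟨r, hr⟩ := Finset.card_eq_one.1 hbp.1
  obtain ⟨s, hs⟩ := Finset.card_eq_one.1 hbq.1
  have hr' := h.simpleFiber_eq hp hp' hr hdp
  have hs' := h.simpleFiber_eq hq hq' hs hdq
  obtain ⟨hpq, T, hT, hTa⟩ := hav.exists_isChebyshev h.pos_a hvw haw hp hq
  obtain ⟨hpq', U, hU, hUc⟩ := hcv.exists_isChebyshev h.pos_c hvw hcw hp' hq'
  obtain ⟨hrs, U', hU', hUb⟩ := hbp.exists_isChebyshev h.pos_b hpq hbq hr hs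
  obtain ⟨-, T', hT', hTd⟩ := hdp.exists_isChebyshev h.pos_d hpq' hdq hr' hs'
  rw [h.natDegree_c] at hU
  rw [h.natDegree_d] at hT'
  obtain rfl := hU'.unique hU
  obtain rfl := hT'.unique hT
  exact ⟨_, _, hT, hU, _, _, _, _, isLinearPoly_lineThrough hvw, isLinearPoly_lineThrough hpq,
    isLinearPoly_lineThrough hrs, isLinearPoly_lineThrough hpq', hTa, hUb, hUc, hTd⟩

end CoprimeCross

/-- **Ritt's second theorem.** -/
theorem ritt_two {a b c d : ℂ[X]} (ha : Indecomposable a) (hb : Indecomposable b)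
    (hc : Indecomposable c) (hd : Indecomposable d) (h : a.comp b = c.comp d)
    (hda : d.natDegree = a.natDegree) (hcb : c.natDegree = b.natDegree)
    (hcop : Nat.Coprime a.natDegree b.natDegree) :
    ∃ L M N M' A B R S : ℂ[X], IsLinearPoly L ∧ IsLinearPoly M ∧ IsLinearPoly N ∧
      IsLinearPoly M' ∧ L.comp A = a.comp M ∧ M.comp B = b.comp N ∧ L.comp R = c.comp M' ∧
      M'.comp S = d.comp N ∧ BasicRittIdentity A B R S := by
  have hX : CoprimeCross a b c d := ⟨h, hda, hcb, hcop, ha.natDegree_pos, hb.natDegree_pos⟩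
  rcases hX.exists_fiber ha hc with ⟨v, hv⟩ | ⟨v, hv⟩ | ⟨v, w, hvw, hav, haw, hcv, hcw⟩
  · obtain ⟨p, k, u, hp, hu, hu0, L, M, N, M', hL, hM, hN, hM', h1, h2, h3, h4⟩ :=
      hX.exists_of_card_fiber_eq_one ha hv
    refine ⟨L, M, N, M', _, _, _, _, hL, hM, hN, hM', h1, h2, h3, h4,
      (basicRittIdentity_of_pow hp hu hu0 (hb.of_comp_eq hM hN h2) (hc.of_comp_eq hL hM' h3) ?_).1⟩
    have h5 := congrArg natDegree h1
    have h6 := congrArg natDegree h3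
    rw [hL.natDegree_comp_left, hM.natDegree_comp_right, natDegree_X_pow] at h5
    rw [hL.natDegree_comp_left, hM'.natDegree_comp_right] at h6
    rw [h6, hcb, h5]
    exact hcop
  · obtain ⟨p, k, u, hp, hu, hu0, L, M, N, M', hL, hM, hN, hM', h1, h2, h3, h4⟩ :=
      hX.symm.exists_of_card_fiber_eq_one hc hv
    refine ⟨L, M', N, M, _, _, _, _, hL, hM', hN, hM, h3, h4, h1, h2,
      (basicRittIdentity_of_pow hp hu hu0 (hd.of_comp_eq hM hN h2) (ha.of_comp_eq hL hM' h3) ?_).2⟩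
    have h5 := congrArg natDegree h1
    have h6 := congrArg natDegree h3
    rw [hL.natDegree_comp_left, hM.natDegree_comp_right, natDegree_X_pow] at h5
    rw [hL.natDegree_comp_left, hM'.natDegree_comp_right] at h6
    rw [h6, h5, hcb]
    exact hcop.symm
  · obtain ⟨T, U, hT, hU, L, M, N, M', hL, hM, hN, hM', h1, h2, h3, h4⟩ :=
      hX.exists_of_isFolded hvw hav haw hcv hcw
    have hodd : ∀ {g : ℂ[X]}, 0 < g.natDegree → IsFolded g v → Odd g.natDegree := by
      intro g hg hgv
      have h5 := (two_mul_card_fiber_le hg v).2.2 hgv.2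
      rw [hgv.1] at h5
      rw [Nat.odd_iff]
      omega
    have hcomp : T.comp U = U.comp T := by
      refine (hT.comp hU).unique ?_
      rw [mul_comm]
      exact hU.comp hT
    have hpT := hT.prime (ha.of_comp_eq hL hM h1)
    have hpU := hU.prime (hb.of_comp_eq hM hN h2)
    refine ⟨L, M, N, M', T, U, U, T, hL, hM, hN, hM', h1, h2, h3, h4, hcomp, Or.inr (Or.inl
      ⟨a.natDegree, b.natDegree, hpT, hpU, hodd hX.pos_a hav, hcb ▸ hodd hX.pos_c hcv, ?_,
        hT, hU, hU, hT⟩)⟩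
    intro heq
    rw [heq, Nat.coprime_self] at hcop
    exact hpU.one_lt.ne' hcop

/-- The composition of a list of polynomials, innermost factor first. -/
def compList (l : List ℂ[X]) : ℂ[X] := l.foldl (fun q p => p.comp q) X

theorem foldl_comp (l : List ℂ[X]) (q : ℂ[X]) :
    l.foldl (fun q p => p.comp q) q = (compList l).comp q := by
  induction l generalizing q with
  | nil => simp [compList]
  | cons a l ih =>
    have h : compList (a :: l) = (compList l).comp a := by
      rw [compList, List.foldl_cons, ih, comp_X]
    rw [List.foldl_cons, ih, h, comp_assoc]

@[simp]
theorem compList_nil : compList [] = X := rfl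

@[simp]
theorem compList_cons (a : ℂ[X]) (l : List ℂ[X]) : compList (a :: l) = (compList l).comp a := by
  rw [compList, List.foldl_cons, foldl_comp, comp_X]

/-- Linear equivalence of lists of polynomials with prescribed linear polynomial on the inside. -/
def LinEquivFrom : ℂ[X] → List ℂ[X] → List ℂ[X] → Prop
  | L, [], [] => L = X
  | L, a :: l, b :: m => ∃ L', IsLinearPoly L' ∧ L'.comp b = a.comp L ∧ LinEquivFrom L' l m
  | _, [], _ :: _ => False
  | _, _ :: _, [] => False

theorem LinEquivFrom.exists_fun {L₀ : ℂ[X]} {l m : List ℂ[X]} (h : LinEquivFrom L₀ l m)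
    (hL₀ : IsLinearPoly L₀) :
    l.length = m.length ∧ ∃ L : ℕ → ℂ[X], L 0 = L₀ ∧ L l.length = X ∧ (∀ i, IsLinearPoly (L i)) ∧
      ∀ i < l.length, (L (i + 1)).comp (m.getD i 0) = (l.getD i 0).comp (L i) := by
  induction l generalizing L₀ m with
  | nil =>
    cases m with
    | nil => exact ⟨rfl, fun _ => X, h.symm, rfl, fun _ => IsLinearPoly.X, by simp⟩
    | cons b m => exact h.elim
  | cons a l ih =>
    cases m with
    | nil => exact h.elim
    | cons b m =>
      obtain ⟨L', hL', he, hr⟩ := h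
      obtain ⟨hlen, L, h0, h1, h2, h3⟩ := ih hr hL'
      refine ⟨by simp [hlen], fun i => Nat.casesOn i L₀ L, rfl, h1, ?_, ?_⟩
      · rintro (_ | i)
        · exact hL₀
        · exact h2 i
      · rintro (_ | i) hi
        · simpa [h0] using he
        · simpa using h3 i (by simpa using hi)

theorem LinEquivFrom.linearEquivalent {l m : List ℂ[X]} (h : LinEquivFrom X l m) :
    LinearEquivalent l m := by
  obtain ⟨hlen, L, h0, h1, h2, h3⟩ := h.exists_fun IsLinearPoly.X
  exact ⟨hlen, L, h0, h1, fun i _ _ => h2 i, h3⟩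

theorem LinEquivFrom.indecomposable {L : ℂ[X]} {l m : List ℂ[X]} (h : LinEquivFrom L l m)
    (hL : IsLinearPoly L) (hm : ∀ p ∈ m, Indecomposable p) : ∀ p ∈ l, Indecomposable p := by
  induction l generalizing L m with
  | nil => simp
  | cons a l ih =>
    cases m with
    | nil => exact h.elim
    | cons b m =>
      obtain ⟨L', hL', he, hr⟩ := h
      intro p hp
      rcases List.mem_cons.1 hp with rfl | hp
      · obtain ⟨M, hM, hLM, -⟩ := hL.exists_inverse
        have h1 : p = (L'.comp b).comp M := by rw [he, comp_assoc, hLM, comp_X]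
        rw [h1]
        exact ((hm b (by simp)).comp_left hL').comp_right hM
      · exact ih hr hL' (fun p hp => hm p (List.mem_cons_of_mem _ hp)) p hp

theorem LinEquivFrom.compList_comp {L : ℂ[X]} {l m : List ℂ[X]} (h : LinEquivFrom L l m) :
    (compList l).comp L = compList m := by
  induction l generalizing L m with
  | nil =>
    cases m with
    | nil => simpa [LinEquivFrom] using h
    | cons b m => exact h.elim
  | cons a l ih =>
    cases m with
    | nil => exact h.elim
    | cons b m =>
      obtain ⟨L', hL', he, hr⟩ := h
      rw [compList_cons, compList_cons, comp_assoc, ← he, ← comp_assoc, ih hr]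

/-- Reachability by Ritt swaps. -/
def SwapReach (l m : List ℂ[X]) : Prop :=
  Relation.ReflTransGen (fun a b => ∃ j : ℕ, RittSwapAt j a b) l m

theorem RittSwapAt.cons {j : ℕ} {l m : List ℂ[X]} (h : RittSwapAt j l m) (a : ℂ[X]) :
    RittSwapAt (j + 1) (a :: l) (a :: m) := by
  obtain ⟨h1, h2, h3, h4⟩ := h
  refine ⟨by simp [h1], by simpa using h2, ?_, by simpa using h4⟩
  rintro (_ | i) hi hi'
  · rfl
  · simpa using h3 i (by omega) (by omega)

theorem SwapReach.cons {l m : List ℂ[X]} (h : SwapReach l m) (a : ℂ[X]) :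
    SwapReach (a :: l) (a :: m) := by
  induction h with
  | refl => exact .refl
  | tail _ hs ih =>
    obtain ⟨j, hj⟩ := hs
    exact ih.tail ⟨j + 1, hj.cons a⟩

theorem SwapReach.length_eq {l m : List ℂ[X]} (h : SwapReach l m) : l.length = m.length := by
  induction h with
  | refl => rfl
  | tail _ hs ih =>
    obtain ⟨j, hj⟩ := hs
    exact ih.trans hj.1

theorem exists_indecomposable_list (E : ℂ[X]) (hE : 0 < E.natDegree) :
    ∃ (L : ℂ[X]) (k : List ℂ[X]), IsLinearPoly L ∧ (∀ p ∈ k, Indecomposable p) ∧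
      (compList k).comp L = E := by
  induction hn : E.natDegree using Nat.strong_induction_on generalizing E with
  | _ n ih =>
    by_cases h1 : E.natDegree = 1
    · exact ⟨E, [], h1, by simp, by simp⟩
    by_cases hdec : Indecomposable E
    · exact ⟨X, [E], IsLinearPoly.X, by simpa using hdec, by simp⟩
    obtain ⟨g, h, hg, hh, rfl⟩ : ∃ g h : ℂ[X], 2 ≤ g.natDegree ∧ 2 ≤ h.natDegree ∧ E = g.comp h := by
      by_contra hcon
      exact hdec ⟨by omega, hcon⟩
    rw [natDegree_comp] at hn
    obtain ⟨L, k, hL, hk, hkL⟩ := ih h.natDegree (by nlinarith) h (by omega) rfl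
    obtain ⟨M, k', hM, hk', hkM⟩ := ih g.natDegree (by nlinarith) g (by omega) rfl
    have happ : ∀ (k k' : List ℂ[X]), compList (k ++ k') = (compList k').comp (compList k) := by
      intro k k'
      rw [compList, List.foldl_append, foldl_comp]
      rfl
    cases k with
    | nil =>
      refine ⟨M.comp L, k', hM.comp hL, hk', ?_⟩
      rw [← hkL, ← hkM, compList_nil, X_comp, comp_assoc]
    | cons a k =>
      obtain ⟨b, k₂, hb⟩ : ∃ b k₂, (∀ p ∈ b :: k₂, Indecomposable p) ∧
          compList (b :: k₂) = M.comp (compList (a :: k)) := by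
        clear hkL hkM ih
        induction k generalizing a with
        | nil =>
          refine ⟨M.comp a, [], ?_, by simp⟩
          simpa using (hk a (by simp)).comp_left hM
        | cons a' k ih =>
          obtain ⟨b, k₂, hb, hb'⟩ := ih a' fun p hp => hk p (List.mem_cons_of_mem _ hp)
          refine ⟨a, b :: k₂, ?_, ?_⟩
          · intro p hp
            rcases List.mem_cons.1 hp with rfl | hp
            · exact hk _ (by simp)
            · exact hb p hp
          · rw [compList_cons, hb', compList_cons a, comp_assoc]
      refine ⟨L, b :: k₂ ++ k', hL, ?_, ?_⟩
      · intro p hp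
        rcases List.mem_append.1 hp with hp | hp
        · exact hb.1 p hp
        · exact hk' p hp
      · rw [happ, hb.2, ← hkL, ← hkM]
        simp only [comp_assoc]

theorem natDegree_compList_pos {l : List ℂ[X]} (hl : ∀ p ∈ l, Indecomposable p) :
    0 < (compList l).natDegree := by
  induction l with
  | nil => simp
  | cons a l ih =>
    rw [compList_cons, natDegree_comp]
    exact Nat.mul_pos (ih fun p hp => hl p (List.mem_cons_of_mem _ hp)) (hl a (by simp)).natDegree_pos

theorem natDegree_compList_cons {a : ℂ[X]} {l : List ℂ[X]}
    (hl : ∀ p ∈ a :: l, Indecomposable p) : 2 ≤ (compList (a :: l)).natDegree := by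
  have h1 := natDegree_compList_pos fun p hp => hl p (List.mem_cons_of_mem _ hp)
  have h2 := (hl a (by simp)).1
  rw [compList_cons, natDegree_comp]
  nlinarith

theorem exists_reach_linEquivFrom (n : ℕ) : ∀ (l m : List ℂ[X]) (L₀ : ℂ[X]), l.length = n →
    IsLinearPoly L₀ → (∀ p ∈ l, Indecomposable p) → (∀ p ∈ m, Indecomposable p) →
    (compList l).comp L₀ = compList m → ∃ l', SwapReach l l' ∧ LinEquivFrom L₀ l' m := by
  induction n with
  | zero =>
    intro l m L₀ hlen hL₀ hl hm h
    obtain rfl := List.length_eq_zero_iff.1 hlen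
    cases m with
    | nil => exact ⟨[], .refl, by simpa [LinEquivFrom] using h⟩
    | cons b m =>
      have h1 := natDegree_compList_cons hm
      rw [← h, compList_nil, X_comp, hL₀] at h1
      omega
  | succ n ih =>
    intro l m L₀ hlen hL₀ hl hm h
    cases l with
    | nil => simp at hlen
    | cons a l =>
    cases m with
    | nil =>
      have h1 := natDegree_compList_cons hl
      rw [← hL₀.natDegree_comp_right, h, compList_nil, natDegree_X] at h1
      omega
    | cons b m =>
    simp only [List.length_cons, Nat.add_right_cancel_iff] at hlen
    have ha := hl a (by simp)
    have hb := hm b (by simp)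
    have hl' : ∀ p ∈ l, Indecomposable p := fun p hp => hl p (List.mem_cons_of_mem _ hp)
    have hm' : ∀ p ∈ m, Indecomposable p := fun p hp => hm p (List.mem_cons_of_mem _ hp)
    rw [compList_cons, compList_cons, comp_assoc] at h
    have ha₀ : Indecomposable (a.comp L₀) := ha.comp_right hL₀
    have h0 : 0 < ((compList l).comp (a.comp L₀)).natDegree := by
      rw [natDegree_comp]
      exact Nat.mul_pos (natDegree_compList_pos hl') ha₀.natDegree_pos
    rcases coprime_or_linear h h0 ha₀ hb with hcop | ⟨M, hM, hbM⟩
    · obtain ⟨E, e, p, q, hep, heq, hE, hdeg⟩ := exists_left_lcm h h0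
      rw [Nat.Coprime.lcm_eq_mul hcop] at hdeg
      have hpd : p.natDegree = b.natDegree := by
        have h1 := hdeg
        rw [hep, natDegree_comp, mul_comm] at h1
        exact Nat.eq_of_mul_eq_mul_left ha₀.natDegree_pos h1
      have hqd : q.natDegree = (a.comp L₀).natDegree := by
        have h1 := hdeg
        rw [heq, natDegree_comp] at h1
        exact Nat.eq_of_mul_eq_mul_right hb.natDegree_pos h1
      have hpq : p.comp (a.comp L₀) = q.comp b := hep.symm.trans heq
      have hp : Indecomposable p := indecomposable_of_cross hpq.symm hb hpd
        (hqd ▸ ha₀.natDegree_pos) hcop.symm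
      have hq : Indecomposable q := indecomposable_of_cross hpq ha₀ hqd
        (hpd ▸ hb.natDegree_pos) hcop
      have hlE : compList l = E.comp p := by
        refine comp_right_cancel ha₀.natDegree_pos ?_
        rw [hE, hep, comp_assoc]
      have hmE : compList m = E.comp q := by
        refine comp_right_cancel hb.natDegree_pos ?_
        rw [← h, hE, heq, comp_assoc]
      have hE0 : 0 < E.natDegree := by
        rw [hE, natDegree_comp] at h0
        exact Nat.pos_of_mul_pos_right h0
      obtain ⟨L, k, hL, hk, hkE⟩ := exists_indecomposable_list E hE0
      obtain ⟨l'', hreach, hlin⟩ := ih l (L.comp p :: k) X hlen IsLinearPoly.X hl'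
        (by
          intro r hr
          rcases List.mem_cons.1 hr with rfl | hr
          · exact hp.comp_left hL
          · exact hk r hr)
        (by rw [comp_X, compList_cons, ← comp_assoc, hkE, hlE])
      cases l'' with
      | nil => exact hlin.elim
      | cons p' k' =>
      obtain ⟨L₁, hL₁, hp', hkk'⟩ := hlin
      rw [comp_X] at hp'
      obtain ⟨N₀, hN₀, hLN₀, hNL₀⟩ := hL₀.exists_inverse
      have hsq : p'.comp a = (L₁.comp (L.comp q)).comp (b.comp N₀) := by
        have h1 : a = (a.comp L₀).comp N₀ := by rw [comp_assoc, hLN₀, comp_X]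
        rw [← hp', h1]
        simp only [comp_assoc] at hpq ⊢
        rw [← comp_assoc a, ← comp_assoc p, ← comp_assoc p, comp_assoc p, hpq]
        simp only [comp_assoc]
      obtain ⟨L₂, M, N, M', A, B, R, S, hL₂, hM, hN, hM', h1, h2, h3, h4, hbasic⟩ := ritt_two
        (hp' ▸ (hp.comp_left hL).comp_left hL₁) ha ((hq.comp_left hL).comp_left hL₁)
        (hb.comp_right hN₀) hsq
        (by rw [hN₀.natDegree_comp_right, ← hp', hL₁.natDegree_comp_left, hL.natDegree_comp_left,
          hpd])
        (by rw [hL₁.natDegree_comp_left, hL.natDegree_comp_left, hqd, hL₀.natDegree_comp_right])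
        (by rw [← hp', hL₁.natDegree_comp_left, hL.natDegree_comp_left, hpd,
          ← hL₀.natDegree_comp_right a]; exact hcop.symm)
      obtain ⟨N', hN', hNN', hN'N⟩ := hN.exists_inverse
      obtain ⟨M₁, hM₁, hM'M₁, hM₁M'⟩ := hM'.exists_inverse
      have hS : M'.comp (S.comp N') = b.comp N₀ := by
        rw [← comp_assoc, h4, comp_assoc, hNN', comp_X]
      have hswap : RittSwapAt 0 (a :: p' :: k') (S.comp N' :: L₂.comp R :: k') := by
        refine ⟨rfl, by simp, ?_, L₂, M, N, A, B, R, S, hL₂, hM, hN, h1, h2, hbasic, rfl, ?_⟩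
        · rintro (_ | _ | i) hi hi'
          · exact absurd rfl hi
          · exact absurd rfl hi'
          · rfl
        · rw [List.getD_cons_zero, comp_assoc, hN'N, comp_X]
      have hM₁b : M₁.comp b = (S.comp N').comp L₀ := by
        have h5 : b = (b.comp N₀).comp L₀ := by rw [comp_assoc, hNL₀, comp_X]
        rw [h5, ← hS, comp_assoc, ← comp_assoc, hM₁M', X_comp]
      have hk'i := hkk'.indecomposable hL₁ hk
      have hlenk : (L₂.comp R :: k').length = n := by
        have h5 := hreach.length_eq
        rw [hlen] at h5
        simpa using h5.symm
      obtain ⟨l₃, hr₃, hl₃⟩ := ih (L₂.comp R :: k') m M₁ hlenk hM₁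
        (by
          intro r hr
          rcases List.mem_cons.1 hr with rfl | hr
          · rw [h3]
            exact ((hq.comp_left hL).comp_left hL₁).comp_right hM'
          · exact hk'i r hr) hm'
        (by
          rw [compList_cons, h3, comp_assoc, comp_assoc, hM'M₁, comp_X, ← comp_assoc,
            hkk'.compList_comp, ← comp_assoc, hkE, hmE])
      exact ⟨S.comp N' :: l₃, ((hreach.cons a).tail ⟨0, hswap⟩).trans (hr₃.cons _),
        M₁, hM₁, hM₁b, hl₃⟩
    · obtain ⟨M', hM', -, hM'M⟩ := hM.exists_inverse
      have hb' : M'.comp b = a.comp L₀ := by rw [hbM, ← comp_assoc, hM'M, X_comp]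
      obtain ⟨l', hreach, hlin⟩ := ih l m M' hlen hM' hl' hm'
        (comp_right_cancel hb.natDegree_pos (by rw [comp_assoc, hb', h]))
      exact ⟨a :: l', hreach.cons a, M', hM', hb', hlin⟩

/-- **Ritt's theorem.**  If `l` and `m` are decompositions of the same polynomial `f`,
then `m` is linearly equivalent to a decomposition obtained from `l` by a finite
sequence of Ritt swaps. -/
theorem ritt_theorem (f : ℂ[X]) (l m : List ℂ[X])
    (hl : IsDecomposition l f) (hm : IsDecomposition m f) :
    ∃ l' : List ℂ[X],
      Relation.ReflTransGen (fun a b => ∃ j : ℕ, RittSwapAt j a b) l l' ∧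
      LinearEquivalent l' m := by
  obtain ⟨l', h1, h2⟩ := exists_reach_linEquivFrom l.length l m X rfl IsLinearPoly.X hl.2.1 hm.2.1
    (comp_X.trans (hl.2.2.trans hm.2.2.symm))
  exact ⟨l', h1, h2.linearEquivalent⟩
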